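/- Let u = √3/2 and let B₂₁ be the arrangement of 21 lines in ℙ²(ℝ) obtained from the seven linear forms x−uz, x+uz, x−4uz, x+4uz, y, y−z, y+z in ℝ[x,y,z] together with their images under the rotations by 60° and 120° about (0:0:1). Let T be the set of all points of ℙ²(ℝ) lying on at least two lines of B₂₁ (there are 115 such points), and let J = ⋂_{P∈T} I(P) ⊆ ℝ[x,y,z]. Then the third symbolic power J^(3) = ⋂_{P∈T} I(P)³ is not contained in J². -/

import Mathlib

open MvPolynomial

noncomputable section

/-- The polynomial ring `ℝ[x,y,z]`, with `x = X 0`, `y = X 1`, `z = X 2`. -/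
abbrev PolyR := MvPolynomial (Fin 3) ℝ

/-- `u = √3 / 2`. -/
def u : ℝ := Real.sqrt 3 / 2

/-- The rotation by 60° about `(0:0:1)`. -/
def rotA : Matrix (Fin 3) (Fin 3) ℝ := !![1/2, -u, 0; u, 1/2, 0; 0, 0, 1]

/-- Linear substitution of variables by a matrix `M`:  `(substMat M f)(v) = f(M v)`. -/
def substMat (M : Matrix (Fin 3) (Fin 3) ℝ) : PolyR →ₐ[ℝ] PolyR :=
  MvPolynomial.aeval fun i => ∑ j, MvPolynomial.C (M i j) * MvPolynomial.X j

/-- The seven initial linear forms of the arrangement `B₂₁`: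
`x ∓ uz`, `x ∓ 4uz`, `y`, `y ∓ z`. -/
def baseFormsB : Fin 7 → PolyR :=
  ![X 0 - C u * X 2, X 0 + C u * X 2, X 0 - C (4*u) * X 2, X 0 + C (4*u) * X 2,
    X 1, X 1 - X 2, X 1 + X 2]

/-- The 21 linear forms defining the arrangement `B₂₁`: the seven initial forms and their
images under the rotations by 60° and 120° about `(0:0:1)` (the image of a line `{ℓ = 0}`
under a matrix `M` being `{ℓ ∘ M⁻¹ = 0}`). -/
def linesB21 : Fin 21 → PolyR := fun i =>
  if h : (i : ℕ) < 7 then baseFormsB ⟨i, h⟩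
  else if h2 : (i : ℕ) < 14 then substMat rotA⁻¹ (baseFormsB ⟨(i : ℕ) - 7, by omega⟩)
  else substMat (rotA ^ 2)⁻¹ (baseFormsB ⟨(i : ℕ) - 14, by omega⟩)

/-- The real projective plane `ℙ²(ℝ)`. -/
abbrev P2R := Projectivization ℝ (Fin 3 → ℝ)

open Classical in
/-- The number of lines of `B₂₁` passing through a point `P ∈ ℙ²(ℝ)`. -/
def multB21 (P : P2R) : ℕ :=
  (Finset.univ.filter fun i => MvPolynomial.eval (Projectivization.rep P) (linesB21 i) = 0).card

/-- The set of intersection points of `B₂₁`: points lying on at least two lines. -/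
def T21 : Set P2R := {P | 2 ≤ multB21 P}

/-- The homogeneous vanishing ideal `I(P)` of the projective point spanned by `v`:
polynomials vanishing on the whole line `ℝ·v`. -/
def pointIdeal (v : Fin 3 → ℝ) : Ideal PolyR where
  carrier := {f | ∀ c : ℝ, MvPolynomial.eval (c • v) f = 0}
  zero_mem' := by intro c; simp
  add_mem' := by intro a b ha hb c; simp [ha c, hb c]
  smul_mem' := by intro a f hf c; simp [smul_eq_mul, hf c]

end


def linL : List (ℤ × ℤ × ℤ) := [
  (1, 0, -1), (1, 0, 1), (1, 0, -4), (1, 0, 4), (0, 1, 0), (0, 1, -1), (0, 1, 1), (1, 2, -2), (1, 2, 2),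
  (1, 2, -8), (1, 2, 8), (3, -2, 0), (3, -2, 4), (3, -2, -4), (1, -2, 2), (1, -2, -2), (1, -2, 8),
  (1, -2, -8), (3, 2, 0), (3, 2, 4), (3, 2, -4)]

def reps : List (ℕ × ℕ × ℕ) := [
  (0, 0, 1), (0, 1, 0), (0, 1, 1), (0, 2, 1), (0, 4, 1), (1, 0, 0), (1, 0, 1), (1, 1, 1), (2, 0, 1),
  (2, 1, 0), (2, 1, 1), (2, 1, 2), (2, 3, 0), (2, 3, 1), (2, 3, 2), (2, 3, 3), (2, 3, 4), (2, 5, 1),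
  (2, 5, 4), (2, 7, 2), (2, 9, 2), (4, 0, 1), (4, 0, 3), (4, 1, 1), (4, 2, 1), (4, 3, 1), (4, 4, 1),
  (4, 6, 1), (4, 8, 1), (6, 1, 1), (6, 1, 4), (6, 5, 2), (6, 7, 1), (8, 0, 1), (10, 1, 1), (10, 3, 2)]

def gG : List (ℤ × ℕ × ℕ × ℕ) := [
  (-963, 10, 0, 0), (-1321644, 8, 2, 0), (1437891, 8, 0, 2), (-2355296, 6, 4, 0), (71684924, 6, 2, 2),
  (-70700544, 6, 0, 4), (496768, 4, 6, 0), (43789136, 4, 4, 2), (-1014525504, 4, 2, 4), (904405248, 4, 0, 6),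
  (1370368, 2, 8, 0), (-49592512, 2, 6, 2), (273351168, 2, 4, 4), (2411747328, 2, 2, 6),
  (-2288467968, 2, 0, 8), (-465920, 0, 10, 0), (21404672, 0, 8, 2), (-312124416, 0, 6, 4),
  (1607831552, 0, 4, 6), (-3051290624, 0, 2, 8), (1453326336, 0, 0, 10)]

def g1 : List (ℤ × ℕ × ℕ × ℕ) := [
  (-270, 12, 2, 0), (270, 12, 0, 2), (-825, 10, 4, 0), (24255, 10, 2, 2), (-23430, 10, 0, 4), (9456, 8, 6, 0),
  (-113040, 8, 4, 2), (-322776, 8, 2, 4), (426360, 8, 0, 6), (-7904, 6, 8, 0), (-105504, 6, 6, 2),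
  (2679264, 6, 4, 4), (-411616, 6, 2, 6), (-2154240, 6, 0, 8), (2304, 4, 10, 0), (92160, 4, 8, 2),
  (-631680, 4, 6, 4), (-11399040, 4, 4, 6), (8219136, 4, 2, 8), (3717120, 4, 0, 10), (-256, 2, 12, 0),
  (-29952, 2, 10, 2), (497664, 2, 8, 4), (-1524224, 2, 6, 6), (13688832, 2, 4, 8), (-10665984, 2, 2, 10),
  (-1966080, 2, 0, 12), (4096, 0, 12, 2), (-110592, 0, 10, 4), (819200, 0, 8, 6), (-1466368, 0, 6, 8),
  (-1867776, 0, 4, 10), (2621440, 0, 2, 12)]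

def g2 : List (ℤ × ℕ × ℕ × ℕ) := [
  (6561, 10, 3, 1), (-6561, 10, 1, 3), (8748, 8, 5, 1), (-355752, 8, 3, 3), (347004, 8, 1, 5),
  (-7776, 6, 7, 1), (-54432, 6, 5, 3), (5152896, 6, 3, 5), (-5090688, 6, 1, 7), (-5760, 4, 9, 1),
  (352512, 4, 7, 3), (-3991680, 4, 5, 5), (-11312640, 4, 3, 7), (14957568, 4, 1, 9), (5376, 2, 11, 1),
  (-220416, 2, 9, 3), (2322432, 2, 7, 5), (-3016704, 2, 5, 7), (13295616, 2, 3, 9), (-12386304, 2, 1, 11),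
  (-1024, 0, 13, 1), (47104, 0, 11, 3), (-709632, 0, 9, 5), (4022272, 0, 7, 7), (-8863744, 0, 5, 9),
  (5505024, 0, 3, 11)]

def g3 : List (ℤ × ℕ × ℕ × ℕ) := [
  (466089, 10, 3, 1), (-466089, 10, 1, 3), (845676, 8, 5, 1), (-23964408, 8, 3, 3), (23118732, 8, 1, 5),
  (-1264224, 6, 7, 1), (567840, 6, 5, 3), (288410304, 6, 3, 5), (-287713920, 6, 1, 7), (544128, 4, 9, 1),
  (8366592, 4, 7, 3), (-144912768, 4, 5, 5), (-662598144, 4, 3, 7), (798600192, 4, 1, 9), (-209664, 2, 11, 1),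
  (2166528, 2, 9, 3), (-4752384, 2, 7, 5), (128354304, 2, 5, 7), (518529024, 2, 3, 9), (-644087808, 2, 1, 11),
  (31744, 0, 13, 1), (-772096, 0, 11, 3), (3075072, 0, 9, 5), (25665536, 0, 7, 7), (-116080640, 0, 5, 9),
  (88080384, 0, 1, 13)]

def g4 : List (ℤ × ℕ × ℕ × ℕ) := [
  (-27, 13, 0, 1), (2340, 11, 2, 1), (1911, 11, 0, 3), (38896, 9, 4, 1), (-212212, 9, 2, 3), (-5148, 9, 0, 5),
  (-27456, 7, 6, 1), (-816816, 7, 4, 3), (3740880, 7, 2, 5), (-466752, 7, 0, 7), (576576, 5, 6, 3),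
  (3267264, 5, 4, 5), (-16363776, 5, 2, 7), (3075072, 5, 0, 9), (-2306304, 3, 6, 5), (-2489344, 3, 4, 7),
  (20500480, 3, 2, 9), (-5750784, 3, 0, 11), (1757184, 1, 6, 7), (-7667712, 1, 2, 11), (3145728, 1, 0, 13)]

def g5 : List (ℤ × ℕ × ℕ × ℕ) := [
  (81, 13, 1, 0), (-140868, 11, 3, 0), (128115, 11, 1, 2), (562848, 9, 5, 0), (3864432, 9, 3, 2),
  (-3891888, 9, 1, 4), (164736, 7, 7, 0), (-22280544, 7, 5, 2), (6918912, 7, 3, 4), (7907328, 7, 1, 6),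
  (-768768, 5, 9, 0), (21415680, 5, 7, 2), (32288256, 5, 5, 4), (-24600576, 5, 3, 6), (412672, 3, 11, 0),
  (-9774336, 3, 9, 2), (12300288, 3, 7, 4), (-32800768, 3, 5, 6), (-65536, 1, 13, 0), (1916928, 1, 11, 2),
  (-12300288, 1, 9, 4), (18743296, 1, 7, 6)]

def g6 : List (ℤ × ℕ × ℕ × ℕ) := [
  (135, 13, 1, 0), (-106476, 11, 3, 0), (85221, 11, 1, 2), (424864, 9, 5, 0), (2905232, 9, 3, 2),
  (-2437776, 9, 1, 4), (122496, 7, 7, 0), (-16605600, 7, 5, 2), (4333824, 7, 3, 4), (-582912, 5, 9, 0),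
  (16228608, 5, 7, 2), (20224512, 5, 5, 4), (11354112, 5, 1, 8), (312320, 3, 11, 0), (-7324416, 3, 9, 2),
  (7704576, 3, 7, 4), (-50462720, 3, 3, 8), (-49152, 1, 13, 0), (1392640, 1, 11, 2), (-7704576, 1, 9, 4),
  (20185088, 1, 5, 8)]

def g7 : List (ℤ × ℕ × ℕ × ℕ) := [
  (-1579797, 13, 1, 0), (646770228, 11, 3, 0), (-398039967, 11, 1, 2), (-2552680416, 9, 5, 0),
  (-17144196784, 9, 3, 2), (9254770096, 9, 1, 4), (-852765056, 7, 7, 0), (99948447456, 7, 5, 2),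
  (-34599721728, 7, 3, 4), (77677343744, 7, 1, 6), (3748110080, 5, 9, 0), (-102877741824, 5, 7, 2),
  (-54239657472, 5, 5, 4), (-162404802560, 5, 3, 6), (-236854345728, 5, 1, 8), (-2011323392, 3, 11, 0),
  (47301892352, 3, 9, 2), (-61106073600, 3, 7, 4), (-173368459264, 3, 5, 6), (759534583808, 3, 3, 8),
  (12070682624, 3, 1, 10), (316817408, 1, 13, 0), (-9005088768, 1, 11, 2), (50544226304, 1, 9, 4),
  (-287597133824, 1, 3, 10), (83969966080, 1, 1, 12)]

def gh : List (ℤ × ℕ × ℕ × ℕ) := [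
  (298377, 14, 1, 0), (1378248222, 12, 3, 0), (-1425226023, 12, 1, 2), (-4851684552, 10, 5, 0),
  (-38111539752, 10, 3, 2), (44935429968, 10, 1, 4), (-5235557184, 8, 7, 0), (243562656480, 8, 5, 2),
  (-181972602240, 8, 3, 4), (-83206835712, 8, 1, 6), (11661844480, 6, 9, 0), (-234564002816, 6, 7, 2),
  (-329804034560, 6, 5, 4), (683650007040, 6, 3, 6), (-26568622080, 6, 1, 8), (-5724113408, 4, 11, 0),
  (101585406208, 4, 9, 2), (19920609280, 4, 7, 4), (-78180630528, 4, 5, 6), (-147603456000, 4, 3, 8),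
  (865515520, 2, 13, 0), (-17579374592, 2, 11, 2), (47267663872, 2, 9, 4), (-492011520, 0, 13, 2),
  (10332241920, 0, 11, 4), (-41328967680, 0, 9, 6), (31488737280, 0, 7, 8)]

def wQ : List (ℤ × ℕ × ℕ × ℕ) := [
  (7494812271840652339352428800, 8, 2, 0), (-7494812271840652339352428800, 2, 7, 0),
  (7494812271840652339352428800, 6, 5, 0), (-22451927140504176165618768000, 8, 2, 1),
  (22451927140504176165618768000, 2, 7, 1), (-22451927140504176165618768000, 6, 5, 1),
  (163930767285396676287026304, 8, 2, 3), (-163930767285396676287026304, 2, 7, 3),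
  (163930767285396676287026304, 6, 5, 3), (-4745386215640565503008000, 8, 2, 4),
  (4745386215640565503008000, 2, 7, 4), (-4745386215640565503008000, 6, 5, 4),
  (14177714669043490611832500, 4, 8, 0), (-14177714669043490611832500, 6, 7, 0),
  (-14177714669043490611832500, 10, 1, 0), (-302512391818116881269243638463200, 4, 4, 0),
  (302512391818116881269243638463200, 2, 5, 0), (-302512391818116881269243638463200, 6, 1, 0),
  (-3284532895103645595932313792000, 4, 4, 2), (3284532895103645595932313792000, 2, 5, 2),
  (-3284532895103645595932313792000, 6, 1, 2), (21796801676788273381117872000, 4, 4, 3),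
  (-21796801676788273381117872000, 2, 5, 3), (21796801676788273381117872000, 6, 1, 3),
  (-1801122005316081873425000, 4, 4, 5), (1801122005316081873425000, 2, 5, 5),
  (-1801122005316081873425000, 6, 1, 5), (7116524953477092759527362022400, 4, 2, 3),
  (-3558262476738546379763681011200, 0, 4, 3), (266647641151132042720059960000, 0, 6, 1),
  (-533295282302264085440119920000, 6, 3, 1), (128216205124859336596660724175, 0, 6, 2),
  (-256432410249718673193321448350, 6, 3, 2), (19214556639235098664702620422741760, 0, 2, 3),
  (-38429113278470197329405240845483520, 2, 1, 3), (-40816052932856220184788241964800, 0, 2, 4),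
  (81632105865712440369576483929600, 2, 1, 4), (230835125983254210919915960000, 0, 2, 5),
  (-461670251966508421839831920000, 2, 1, 5), (-1716694073927424587748392325, 0, 2, 6),
  (3433388147854849175496784650, 2, 1, 6), (9746072710500173206481280, 0, 2, 7),
  (-19492145421000346412962560, 2, 1, 7)]

def lam1 : List (ℤ × ℕ × ℕ × ℕ) := [
  (-933921099311316620165902337386410504322956656640000000, 0, 1, 0),
  (191541341312213943897599751479111661997604984586240000, 0, 1, 1),
  (16565083854439839647265844595035633979567898624000, 0, 2, 1),
  (-5060647748233757708209089571015367306772480000, 0, 4, 1),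
  (-31902324582797103856990936910490311331434987520000, 1, 1, 1),
  (-7125252527704747163130968760577472719749120000000, 2, 1, 0),
  (16565083854439839647265844595035633979567898624000, 2, 1, 1),
  (1461344461915694762402341853936093612652625920000, 2, 1, 2),
  (45611449865701740053737856277615651940466688000, 2, 3, 0),
  (33445719475489961076447721734621300051148800000, 2, 3, 1),
  (-262750768900114214438171788833796789370880000, 2, 3, 2),
  (27465378945068189710946726340381691084800000, 2, 3, 3),
  (-206541491934873856804381604572456550400000, 2, 3, 4),
  (-31010861394425642754637552895508464271360000, 2, 5, 1),
  (-61640205087772760085908596718944911360000, 2, 5, 4),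
  (-438929489372836604201982642656284508160000, 2, 7, 2),
  (15009241090459765402433455464539750400000, 2, 9, 2),
  (-7681822676377000545262351083889471499796480000, 4, 1, 1),
  (-5060647748233757708209089571015367306772480000, 4, 2, 1),
  (727851401595029782403650634320106540236800000, 4, 3, 1),
  (111566667959184875324066650517998518927360000, 4, 4, 1),
  (1763591856191002358726994246968436326400000, 4, 6, 1),
  (-14409734590651189850201988938701209600000, 4, 8, 1),
  (-142577529353610518078704203413506983198720000, 6, 1, 1),
  (-59783245396105930694468281959532462080000, 6, 1, 4),
  (-380321833455653677678679793200340664320000, 6, 5, 2),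
  (-79677177706588157637884131627184947200000, 6, 7, 1),
  (65267443115936967787682142688483737600000, 10, 1, 1), (9456175587567997653382165835022336000000, 10, 3, 2)]

def lam2 : List (ℤ × ℕ × ℕ × ℕ) := [
  (34229154299758099117001712673362368947814400000000, 0, 0, 1),
  (191590512902410073494522066598545587024157936189440000, 0, 1, 1),
  (528946366940076445580609316527981513932800000000, 0, 2, 1),
  (-2732127324268092343934555600698810879180800000, 0, 4, 1),
  (-2002931863617142867260217769881105740167884308480000, 1, 0, 1),
  (220180050246887815471669846348460066513300226048000, 1, 1, 1),
  (-21989583618343928987198574875529914021490720768000, 2, 0, 1),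
  (1057892733880152891161218633055963027865600000000, 2, 1, 1),
  (2923439222754059959328034463478783981691863040000, 2, 1, 2),
  (14755752287435766840945258788973471879659520000, 2, 3, 1),
  (-335534418004515517993142316826323150962688000, 2, 3, 2),
  (4928359092799694575531769582115102916608000, 2, 3, 3),
  (-233171957500411996997452547061385789440000, 2, 3, 4),
  (-21084248437149216133860680874827723046912000, 2, 5, 1),
  (12816165704681061643156563301364662272000, 2, 5, 4), (-67467682303446556886620091128228085760000, 2, 7, 2),
  (-501589214195085302090840445309419520000, 2, 9, 2),
  (7377876143717883420472629394486735939829760000, 4, 0, 1),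
  (2464179546399847287765884791057551458304000, 4, 0, 3),
  (-8843124054877347104243068584359111656734720000, 4, 1, 1),
  (-5464254648536184687869111201397621758361600000, 4, 2, 1),
  (-65744301482978220715650638847596235325440000, 4, 3, 1),
  (-21084248437149216133860680874827723046912000, 4, 4, 1),
  (1268106095418137811318368378409009020928000, 4, 6, 1),
  (-19912865222823815788035002282551541760000, 4, 8, 1),
  (-21084248437149216133860680874827723046912000, 6, 1, 1),
  (12816165704681061643156563301364662272000, 6, 1, 4), (-67467682303446556886620091128228085760000, 6, 5, 2),
  (-19912865222823815788035002282551541760000, 6, 7, 1),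
  (634053047709068905659184189204504510464000, 8, 0, 1),
  (-19912865222823815788035002282551541760000, 10, 1, 1),
  (-501589214195085302090840445309419520000, 10, 3, 2)]

def lam3 : List (ℤ × ℕ × ℕ × ℕ) := [
  (1334937017690565865563066794261132388964761600000000, 0, 0, 1),
  (10151116290613667028870832868893328410562669335019520000, 0, 1, 1),
  (917686705549280885423565391493446981310893522944000, 0, 2, 1),
  (-131328505794434767977236109172244498538823680000, 0, 4, 1),
  (-30065730931599626265459962840430343534639023390720000, 1, 0, 1),
  (-2420478186613351815275339271140112536563957628928000, 1, 1, 1),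
  (-1204884466750978986373504365656741222170924941312000, 2, 0, 1),
  (-855799980617291941290634101459673144180755922944000, 2, 1, 1),
  (93574323417421810684114447960941354913816903680000, 2, 1, 2),
  (949388038686304044635536766627628857142804480000, 2, 3, 1),
  (-10436224491846166268377143057100362536189952000, 2, 3, 2),
  (1528266570580563397336334505043534609907712000, 2, 3, 3),
  (-11890503642592002242104238611393318748160000, 2, 3, 4),
  (1500022218848154704351935467280307387891712000, 2, 5, 1),
  (-3585300820953007682292563495037060513792000, 2, 5, 4),
  (-19981353678454791167606394373395437322240000, 2, 7, 2),
  (576664354162579497975949663743686737920000, 2, 9, 2),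
  (-86176529871311684440239127472680752182722560000, 4, 0, 1),
  (-1239957563651781264667725984489801089286144000, 4, 0, 3),
  (150003613075779835179389677548093197695057920000, 4, 1, 1),
  (-188330391144932036263106896109516374325329920000, 4, 2, 1),
  (-46887101839807542869572074484731073014005760000, 4, 3, 1),
  (-3335093617777655492027697495524033490321408000, 4, 4, 1),
  (27976734456724198762732801118276935483392000, 4, 6, 1),
  (-448559175268879963487275712363353866240000, 4, 8, 1),
  (-631785668216957499985937634111117494059008000, 6, 1, 1),
  (5225682581935526361839961339408792158208000, 6, 1, 4),
  (10943198103683448345525181742794628136960000, 6, 5, 2),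
  (-372391928091496672115242000686765834240000, 6, 7, 1),
  (46207472125236863199391749018650092240896000, 8, 0, 1),
  (-1508854127710009811597577554008410685440000, 10, 1, 1),
  (-277630093860614997198964878743363911680000, 10, 3, 2)]

def lam4 : List (ℤ × ℕ × ℕ × ℕ) := [
  (3604084339143337681231601414652643000864210944000000, 1, 1, 1),
  (-64075556945615564574708687724918264447679594496000, 2, 1, 1),
  (-1459986162141894837834206865337944312297553920000, 2, 1, 2),
  (-26708121391164938417047976704118818131148800000, 2, 3, 1),
  (-189258415023567066668243378509017167953920000, 2, 3, 2),
  (-95432897568669664920756820810074685440000000, 2, 3, 3),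
  (199771235719709597085970662571376640000000, 2, 3, 4),
  (64364474989540428381946663366974190387200000, 2, 5, 1),
  (127775546558818114979477173274306150400000, 2, 5, 4),
  (-233303841867032206647107613671345356800000, 2, 7, 2), (1906907250051773426729719960908595200000, 2, 9, 2),
  (96508163123533888796790046302411053806387200000, 4, 1, 1),
  (1769681439141369040270602910356491017912320000, 4, 2, 1),
  (-2666049568840384496942057116972921493913600000, 4, 3, 1),
  (-50757330644407433436616026223605354332160000, 4, 4, 1),
  (1534243090327369705620254688548172595200000, 4, 6, 1),
  (-27058623800440789035293703650515353600000, 4, 8, 1),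
  (-115121805633947861818562689590579544719360000, 6, 1, 1),
  (82009772557575552737963894212499865600000, 6, 1, 4), (502995010088640162713168008142703820800000, 6, 5, 2),
  (-25245117915264996383578615277263257600000, 6, 7, 1), (1813505885175792651715088373252096000000, 10, 1, 1),
  (-22247251250604023311846732877266944000000, 10, 3, 2)]

def lam5 : List (ℤ × ℕ × ℕ × ℕ) := [
  (35720631606430401106452123708200624347834262974384570368000, 1, 0, 0),
  (2331560620741467772430921214197771358169863290880000, 1, 0, 1),
  (-12337469116015560076382203815970903261636196302848000, 1, 1, 1),
  (-289778573583402629202671864382612956848437854208000, 2, 0, 1), (0, 2, 1, 0), (0, 2, 1, 1), (0, 2, 1, 2),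
  (-4158428824323974678578335292195042635760533504000, 2, 3, 0),
  (-3077481061942748623788082072941537612917637120000, 2, 3, 1),
  (4421670129141275470011472540017897901129728000, 2, 3, 2),
  (356337222222257214378494334429743082897408000, 2, 3, 3),
  (-271429380022625878037759244232179056640000, 2, 3, 4),
  (-3115296325545121892323623798497508895752192000, 2, 5, 1),
  (-718135218835410200780153030993585897472000, 2, 5, 4),
  (14493285314966588369057244976521160949760000, 2, 7, 2),
  (-520552044789012176205651735946104668160000, 2, 9, 2),
  (1538740530971374311894041036470768806458818560000, 4, 0, 1),
  (-178168611111128607189247167214871541448704000, 4, 0, 3),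
  (-1899663892803300670709071213562581608006942720000, 4, 1, 1), (0, 4, 2, 1),
  (-68229797614585403959627184333927831065067520000, 4, 3, 1),
  (-3115296325545121892323623798497508895752192000, 4, 4, 1),
  (286226319496592435161256421032502365257728000, 4, 6, 1),
  (-4730756463011842731179762322245513379840000, 4, 8, 1),
  (3115296325545121892323623798497508895752192000, 6, 1, 1),
  (718135218835410200780153030993585897472000, 6, 1, 4),
  (14493285314966588369057244976521160949760000, 6, 5, 2),
  (-4730756463011842731179762322245513379840000, 6, 7, 1),
  (-143113159748296217580628210516251182628864000, 8, 0, 1),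
  (4730756463011842731179762322245513379840000, 10, 1, 1),
  (520552044789012176205651735946104668160000, 10, 3, 2)]

def lam6 : List (ℤ × ℕ × ℕ × ℕ) := [
  (31828213796349808172847435340313230418225740268206817280000, 1, 0, 0),
  (6196912766954336076249331593106490519058760335360000, 1, 0, 1),
  (-20278681484299358015677715570788923344881667014656000, 1, 1, 1),
  (-306259356660341258709559260281740559150047297536000, 2, 0, 1), (0, 2, 1, 0), (0, 2, 1, 1), (0, 2, 1, 2),
  (-3705291752278549616789379545989589581525155840000, 2, 3, 0),
  (-2341050164869317134175904752633054232408227840000, 2, 3, 1),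
  (4673146921697101725914905704982613512421376000, 2, 3, 2),
  (614731774926261671393517592304386704408576000, 2, 3, 3),
  (-721415594098430135782031760679847854080000, 2, 3, 4),
  (-3019880247570418454500431462779580888121344000, 2, 5, 1),
  (-1180374615610306967031077689653549072384000, 2, 5, 4),
  (12748266689310082976225434568739646341120000, 2, 7, 2),
  (-409174277897545303119986833621537259520000, 2, 9, 2),
  (1170525082434658567087952376316527116204113920000, 4, 0, 1),
  (-307365887463130835696758796152193352204288000, 4, 0, 3),
  (-1670940811501251195859820159793842925223280640000, 4, 1, 1), (0, 4, 2, 1),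
  (-53631290952587057970542914256442131679805440000, 4, 3, 1),
  (-3019880247570418454500431462779580888121344000, 4, 4, 1),
  (211978714102977703241156571622245679497216000, 4, 6, 1),
  (-3354745402330132231623302437562461716480000, 4, 8, 1),
  (3019880247570418454500431462779580888121344000, 6, 1, 1),
  (1180374615610306967031077689653549072384000, 6, 1, 4),
  (12748266689310082976225434568739646341120000, 6, 5, 2),
  (-3354745402330132231623302437562461716480000, 6, 7, 1),
  (-105989357051488851620578285811122839748608000, 8, 0, 1),
  (3354745402330132231623302437562461716480000, 10, 1, 1),
  (409174277897545303119986833621537259520000, 10, 3, 2)]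

def lam7 : List (ℤ × ℕ × ℕ × ℕ) := [
  (-240695109670555640271948074278440930767442253578184232534016000, 1, 0, 0),
  (-32142056688775155322302793130146280100392240771235840000, 1, 0, 1),
  (226187049932496832138852831653884534781575893346156544000, 1, 1, 1),
  (2892504007657978011512787543494125233320352949469184000, 2, 0, 1),
  (228236088967438461129411191338817606159003811840000000, 2, 1, 0),
  (-530612766025416943581219534068181427633518928723968000, 2, 1, 1),
  (-46809785804083534629271814265280950600488913469440000, 2, 1, 2),
  (26559572692368946828413532584576774491200743800832000, 2, 3, 0),
  (14317121676689750779642080802877913158903408885760000, 2, 3, 1),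
  (-35719675885880512606053302907630222386065833984000, 2, 3, 2),
  (-6569466238163221671147317701215225988182441984000, 2, 3, 3),
  (10357764943261221868902798070478314741432320000, 2, 3, 4),
  (20798839357872717943591162737343296851008290816000, 2, 5, 1),
  (11250842188960231434273120197142278471417856000, 2, 5, 4),
  (-88622835698220600563873257866506400442613760000, 2, 7, 2),
  (2699455052711636315348442317291738187694080000, 2, 9, 2),
  (-7694227481464322606421427112740651321070903623680000, 4, 0, 1),
  (2844847609897398709163136081540059829677064192000, 4, 0, 3),
  (13212752893374902982053295423789427930184024064000000, 4, 1, 1),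
  (162102668671423726909353557138764245570536079360000, 4, 2, 1),
  (314121235502289153492950028289874686239320309760000, 4, 3, 1),
  (25365882778127570058688215781084752536829689856000, 4, 4, 1),
  (-1306989506046203941293246430323027797914681344000, 4, 6, 1),
  (20855963301786559858313271186379083633131520000, 4, 8, 1),
  (-24372542865941327869971665686735825409289486336000, 6, 1, 1),
  (-11191360056116759555206504034768778896080896000, 6, 1, 4),
  (-86745515263881397061478820992733607236730880000, 6, 5, 2),
  (18765316563896866906138236791781572550328320000, 6, 7, 1),
  (625249065854346876869251675302067422753718272000, 8, 0, 1),
  (-18303743945489127992856566682097095404421120000, 10, 1, 1),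
  (-2877330846900265419886053226704440005754880000, 10, 3, 2)]

def lam8 : List (ℤ × ℕ × ℕ × ℕ) := [
  (-8301528334011732262648191371245228616175530803200000000, 0, 0, 1),
  (287275448625007078927671793195124416650453452933038080000000, 0, 1, 0),
  (1517062374538476748080079098850513000471016495193784320000, 0, 1, 1),
  (3276885891801332885384460656653487975681322249093120000, 0, 2, 1),
  (4607162389650724970207171730248418091771971502080000, 0, 4, 1),
  (-230914674921025916112642875840391306528210889150334704287744000, 1, 0, 0),
  (-18810837072739615644527437936222945920659695966617600000, 1, 0, 1),
  (-13914825569523591016253303256724450292325306649804800000, 1, 1, 1),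
  (6225560490836280347646681205866673566889362988204032000, 2, 0, 1),
  (8766950946808077359853265173191052754225264066560000000, 2, 1, 0),
  (6553771783602665770768921313306975951362644498186240000, 2, 1, 1),
  (46297069535475974978029757655350128188202407690240000, 2, 1, 2),
  (156211830738277427208541261065918835771690067165184000, 2, 3, 0),
  (43921853651099778732658032244500485913124074946560000, 2, 3, 1),
  (-85298611216982605989826991997383724186300579840000, 2, 3, 2),
  (2518715119673241291670734566292858638885191680000, 2, 3, 3),
  (5088840264017471300212395008929651878789120000, 2, 3, 4),
  (226622314986798265633704588224892284252568158208000, 2, 5, 1),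
  (-17157129785826619751889981819607312773414912000, 2, 5, 4),
  (-261154686402572215238663809677505995158323200000, 2, 7, 2),
  (-7298538910890615918338640161137249033912320000, 2, 9, 2),
  (-77038349812782226796866549535217965584122642432000000, 4, 0, 1),
  (11516081514846661270976484651355851252031291392000, 4, 0, 3),
  (83413946660262361251061200649692287057671068057600000, 4, 1, 1),
  (9214324779301449940414343460496836183543943004160000, 4, 2, 1),
  (1710495041786832910248604724369309071593292431360000, 4, 3, 1),
  (291911667664594487521282064945891206587104624640000, 4, 4, 1),
  (-14281149340488897141306382738785972301143736320000, 4, 6, 1),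
  (202243385185677427608330482393635949075496960000, 4, 8, 1),
  (-34535095724386621916605318659103405085577707520000, 6, 1, 1),
  (-72826457754399095833758431835878197674639360000, 6, 1, 4),
  (-874734887747428989829375919545165418720133120000, 6, 5, 2),
  (304269830554137977460713114386214082419097600000, 6, 7, 1),
  (11315012246636215649759914402521548985785647104000, 8, 0, 1),
  (-511941732393546421358347941554410984329707520000, 10, 1, 1),
  (-74095782802826660689848828331596228046356480000, 10, 3, 2)]


/-! Computable side -/

def cls (d px py : ℕ) : List (ℕ × ℕ × ℕ) :=
  (List.range (d + 1)).flatMap fun i => (List.range (d + 1 - i)).filterMap fun j =>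
    if i % 2 = px ∧ j % 2 = py then some (i, j, d - i - j) else none

/-- value of a monomial at a point with natural coordinates -/
def mval (m q : ℕ × ℕ × ℕ) : ℕ :=
  Nat.mul (Nat.pow q.1 m.1) (Nat.mul (Nat.pow q.2.1 m.2.1) (Nat.pow q.2.2 m.2.2))

def dval (D : List (ℤ × ℕ × ℕ × ℕ)) (q : ℕ × ℕ × ℕ) : ℤ :=
  (D.map fun t => t.1 * (mval t.2 q : ℤ)).sum

def look (D : List (ℤ × ℕ × ℕ × ℕ)) (m : ℕ × ℕ × ℕ) : ℤ :=
  (D.map fun t => if t.2 = m then t.1 else 0).sum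

def cmb (p q : ℤ) : List ℤ → List ℤ → List ℤ
  | x :: r, y :: s => Int.sub (Int.mul p x) (Int.mul q y) :: cmb p q r s
  | [], s => s.map fun y => Int.mul (Int.neg q) y
  | r, [] => r.map fun x => Int.mul p x

def content (r : List ℤ) : ℕ := r.foldr (fun x g => Nat.gcd x.natAbs g) 0

def nrm (r : List ℤ) : List ℤ := r.map fun x => Int.tdiv x (Int.ofNat (content r))

def redRow (h : ℤ) (t : List ℤ) (r : List ℤ) : List ℤ :=
  if r.headD 0 = 0 then r.tail else nrm (cmb h (r.headD 0) r.tail t)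

def elim : ℕ → List (List ℤ) → Bool
  | 0, _ => true
  | n + 1, rows =>
    match rows.find? fun r => decide (r.headD 0 ≠ 0) with
    | none => false
    | some r => elim n (rows.map (redRow (r.headD 0) r.tail))

def unitRows (d px py : ℕ) (fr : List (ℕ × ℕ × ℕ)) : List (List ℤ) :=
  fr.map fun f => (cls d px py).map fun m => if m = f then 1 else 0

def evalRows (d px py : ℕ) : List (List ℤ) :=
  reps.map fun q => (cls d px py).map fun m => (mval m q : ℤ)

def frRows (Ds : List (List (ℤ × ℕ × ℕ × ℕ))) (fr : List (ℕ × ℕ × ℕ)) : List (List ℤ) :=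
  fr.map fun f => Ds.map fun D => look D f

/-- all checks that make the dictionaries `Ds` span the class `(d, px, py)` of the ideal -/
def spanCheck (d px py : ℕ) (Ds : List (List (ℤ × ℕ × ℕ × ℕ))) (fr : List (ℕ × ℕ × ℕ)) : Bool :=
  decide (Ds.length = fr.length) && elim Ds.length (frRows Ds fr) &&
  (Ds.all fun D => D.all fun t => decide (t.2 ∈ cls d px py)) &&
  (Ds.all fun D => reps.all fun q => decide (dval D q = 0)) &&
  elim (cls d px py).length (unitRows d px py fr ++ evalRows d px py)

def shx (D : List (ℤ × ℕ × ℕ × ℕ)) : List (ℤ × ℕ × ℕ × ℕ) := D.map fun t => (t.1, t.2.1 + 1, t.2.2.1, t.2.2.2)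
def shy (D : List (ℤ × ℕ × ℕ × ℕ)) : List (ℤ × ℕ × ℕ × ℕ) := D.map fun t => (t.1, t.2.1, t.2.2.1 + 1, t.2.2.2)
def shz (D : List (ℤ × ℕ × ℕ × ℕ)) : List (ℤ × ℕ × ℕ × ℕ) := D.map fun t => (t.1, t.2.1, t.2.2.1, t.2.2.2 + 1)

def annih (d px py : ℕ) (l : List (ℤ × ℕ × ℕ × ℕ)) : Bool :=
  (cls d px py).all fun m => decide ((l.map fun t => t.1 * (mval m t.2 : ℤ)).sum = 0)

def lamCheck (d px py : ℕ) (D lam : List (ℤ × ℕ × ℕ × ℕ)) : Bool :=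
  (D.all fun t => decide (t.2.1 % 2 = px) && decide (t.2.2.1 % 2 = py)) &&
  (lam.all fun t => decide (t.2 ∈ reps)) &&
  annih d px (1 - py) (wQ.map (fun t => (t.1 * dval D t.2, t.2)) ++ lam.map (fun t => (-t.1, t.2)))


/-! Soundness of the elimination -/

def dotR : List ℤ → List ℝ → ℝ
  | a :: r, x :: v => (a : ℝ) * x + dotR r v
  | _, _ => 0

theorem dotR_nil_left (v : List ℝ) : dotR [] v = 0 := by cases v <;> rfl
theorem dotR_nil_right (r : List ℤ) : dotR r [] = 0 := by cases r <;> rfl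
theorem dotR_cons' (r : List ℤ) (x : ℝ) (v : List ℝ) :
    dotR r (x :: v) = (r.headD 0 : ℝ) * x + dotR r.tail v := by
  cases r with
  | nil => simp [dotR_nil_left]
  | cons a r => simp [dotR]

theorem dotR_map (c : ℤ) (f : ℤ → ℤ) (r : List ℤ) (v : List ℝ)
    (h : ∀ x ∈ r, c * f x = x) : (c : ℝ) * dotR (r.map f) v = dotR r v := by
  induction r generalizing v with
  | nil => simp [dotR_nil_left]
  | cons a r ih =>
    cases v with
    | nil => simp [dotR_nil_right]
    | cons x v =>
      have h1 : ((c * f a : ℤ) : ℝ) = a := by rw [h a (by simp)]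
      push_cast at h1
      simp only [List.map_cons, dotR]
      rw [mul_add, ih v (fun y hy => h y (by simp [hy])), ← h1]; ring

theorem dotR_smul (c : ℤ) (r : List ℤ) (v : List ℝ) :
    dotR (r.map fun x => Int.mul c x) v = (c : ℝ) * dotR r v := by
  induction r generalizing v with
  | nil => simp [dotR_nil_left]
  | cons a r ih =>
    cases v with
    | nil => simp [dotR_nil_right]
    | cons x v =>
      have e : Int.mul c a = c * a := rfl
      simp only [List.map_cons, dotR, ih v, e]; push_cast; ring

theorem dotR_cmb (p q : ℤ) (r s : List ℤ) (v : List ℝ) :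
    dotR (cmb p q r s) v = (p : ℝ) * dotR r v - (q : ℝ) * dotR s v := by
  induction r generalizing s v with
  | nil =>
    have : cmb p q [] s = s.map fun y => Int.mul (Int.neg q) y := by cases s <;> simp [cmb]
    rw [this, dotR_smul, dotR_nil_left]
    have : Int.neg q = -q := rfl
    rw [this]; push_cast; ring
  | cons a r ih =>
    cases s with
    | nil =>
      have : cmb p q (a :: r) [] = (a :: r).map fun x => Int.mul p x := by simp [cmb]
      rw [this, dotR_smul, dotR_nil_left]; ring
    | cons b s =>
      cases v with
      | nil => simp [dotR_nil_right]
      | cons x v =>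
        have e : Int.sub (Int.mul p a) (Int.mul q b) = p * a - q * b := rfl
        simp only [cmb, dotR, ih, e]; push_cast; ring

theorem content_dvd (r : List ℤ) : ∀ x ∈ r, (content r : ℤ) ∣ x := by
  induction r with
  | nil => simp
  | cons a r ih =>
    intro x hx
    have hc : content (a :: r) = Nat.gcd a.natAbs (content r) := rfl
    rcases List.mem_cons.1 hx with rfl | hx
    · rw [hc]; exact Int.natCast_dvd.2 (Nat.gcd_dvd_left _ _)
    · rw [hc]; exact (Int.natCast_dvd_natCast.2 (Nat.gcd_dvd_right _ _)).trans (ih x hx)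

theorem dotR_zero (r : List ℤ) (v : List ℝ) (h : ∀ x ∈ r, x = 0) : dotR r v = 0 := by
  induction r generalizing v with
  | nil => simp [dotR_nil_left]
  | cons a r ih =>
    cases v with
    | nil => simp [dotR_nil_right]
    | cons x v =>
      simp only [dotR, h a (by simp), ih v (fun y hy => h y (by simp [hy]))]; simp

theorem dotR_nrm (r : List ℤ) (v : List ℝ) (h : dotR r v = 0) : dotR (nrm r) v = 0 := by
  by_cases hg : content r = 0
  · apply dotR_zero
    intro x hx
    simp only [nrm, List.mem_map] at hx
    obtain ⟨y, hy, rfl⟩ := hx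
    rw [hg]; simp
  · have := dotR_map (content r : ℤ) (fun x => Int.tdiv x (Int.ofNat (content r))) r v
      (fun x hx => Int.mul_tdiv_cancel' (content_dvd r x hx))
    rw [h] at this
    rcases mul_eq_zero.1 this with h1 | h1
    · exfalso; apply hg; exact_mod_cast h1
    · exact h1

theorem elim_sound (n : ℕ) (rows : List (List ℤ)) (v : List ℝ) (hv : v.length = n)
    (h : ∀ r ∈ rows, dotR r v = 0) (he : elim n rows = true) : ∀ x ∈ v, x = 0 := by
  induction n generalizing rows v with
  | zero => rw [List.length_eq_zero_iff.1 hv]; simp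
  | succ n ih =>
    cases v with
    | nil => simp
    | cons x v =>
      simp only [elim] at he
      split at he
      · simp at he
      · rename_i r hr
        have hmem := List.mem_of_find?_eq_some hr
        have hne : r.headD 0 ≠ 0 := by simpa using List.find?_some hr
        have hr0 := h r hmem
        rw [dotR_cons'] at hr0
        have hz := ih (rows.map (redRow (r.headD 0) r.tail)) v (by simpa using hv) (by
          intro s hs
          obtain ⟨s, hs', rfl⟩ := List.mem_map.1 hs
          have hs0 := h s hs'
          rw [dotR_cons'] at hs0
          unfold redRow
          split
          · rename_i h0; rw [h0] at hs0; simpa using hs0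
          · apply dotR_nrm
            rw [dotR_cmb]
            linear_combination (r.headD 0 : ℝ) * hs0 - (s.headD 0 : ℝ) * hr0) he
        have hd : dotR r.tail v = 0 := by
          have : ∀ (r : List ℤ) (v : List ℝ), (∀ x ∈ v, x = 0) → dotR r v = 0 := by
            intro r v hv
            induction r generalizing v with
            | nil => simp [dotR_nil_left]
            | cons a r ih =>
              cases v with
              | nil => simp [dotR_nil_right]
              | cons x v =>
                simp only [dotR, hv x (by simp), ih v (fun y hy => hv y (by simp [hy]))]; simp
          exact this _ _ hz
        rw [hd, add_zero] at hr0
        intro y hy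
        rcases List.mem_cons.1 hy with rfl | hy
        · rcases mul_eq_zero.1 hr0 with h1 | h1
          · exfalso; apply hne; exact_mod_cast h1
          · exact h1
        · exact hz y hy

theorem dotR_map_map {α : Type*} (l : List α) (f : α → ℤ) (g : α → ℝ) :
    dotR (l.map f) (l.map g) = (l.map fun a => (f a : ℝ) * g a).sum := by
  induction l with
  | nil => rfl
  | cons a l ih => simp [dotR, ih]

theorem span14a : spanCheck 14 0 0 [g1] [(12, 2, 0)] = true := by decide +kernel
theorem span14b : spanCheck 14 0 1 [g2, g3] [(8, 5, 1), (10, 3, 1)] = true := by decide +kernel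
theorem span14c : spanCheck 14 1 0 [g4] [(13, 0, 1)] = true := by decide +kernel
theorem span14d : spanCheck 14 1 1 [g5, g6, g7] [(9, 5, 0), (11, 3, 0), (13, 1, 0)] = true := by
  decide +kernel
theorem lc1 : lamCheck 17 0 0 g1 lam1 = true := by decide +kernel
theorem span13a : spanCheck 13 0 0 [] [] = true := by decide +kernel
theorem span13b : spanCheck 13 0 1 [] [] = true := by decide +kernel
theorem span13c : spanCheck 13 1 0 [] [] = true := by decide +kernel
theorem span13d : spanCheck 13 1 1 [] [] = true := by decide +kernel
theorem span15a : spanCheck 15 0 0 [shz g1, shy g2, shy g3, shx g4]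
    [(8, 6, 1), (10, 4, 1), (12, 2, 1), (14, 0, 1)] = true := by decide +kernel
theorem span15b : spanCheck 15 0 1 [shy g1, shz g2, shz g3, shx g5, shx g6, shx g7, gh]
    [(8, 3, 4), (8, 5, 2), (8, 7, 0), (10, 3, 2), (10, 5, 0), (12, 3, 0), (14, 1, 0)] = true := by
  decide +kernel
theorem span15c : spanCheck 15 1 0 [shx g1, shz g4, shy g5, shy g6, shy g7]
    [(9, 6, 0), (11, 2, 2), (11, 4, 0), (13, 0, 2), (13, 2, 0)] = true := by decide +kernel
theorem span15d : spanCheck 15 1 1 [shx g2, shx g3, shz g5, shz g6, shz g7]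
    [(7, 7, 1), (9, 3, 3), (9, 5, 1), (11, 3, 1), (13, 1, 1)] = true := by decide +kernel
theorem lc2 : lamCheck 17 0 1 g2 lam2 = true := by decide +kernel
theorem lc3 : lamCheck 17 0 1 g3 lam3 = true := by decide +kernel
theorem lc4 : lamCheck 17 1 0 g4 lam4 = true := by decide +kernel
theorem lc5 : lamCheck 17 1 1 g5 lam5 = true := by decide +kernel
theorem lc6 : lamCheck 17 1 1 g6 lam6 = true := by decide +kernel
theorem lc7 : lamCheck 17 1 1 g7 lam7 = true := by decide +kernel
theorem lch : lamCheck 16 0 1 gh lam8 = true := by decide +kernel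

def lval (l q : ℤ × ℤ × ℤ) : ℤ := l.1 * q.1 + l.2.1 * q.2.1 + l.2.2 * q.2.2
def sgn (sx sy : ℤ) (q : ℕ × ℕ × ℕ) : ℤ × ℤ × ℤ := (sx * q.1, sy * q.2.1, q.2.2)
def ivalD (D : List (ℤ × ℕ × ℕ × ℕ)) (q : ℤ × ℤ × ℤ) : ℤ :=
  (D.map fun t => t.1 * (q.1 ^ t.2.1 * (q.2.1 ^ t.2.2.1 * q.2.2 ^ t.2.2.2))).sum
def fval (q : ℤ × ℤ × ℤ) : ℤ := (linL.map fun l => lval l q).prod * ivalD gG q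

theorem phi_f_check : (wQ.map fun t => t.1 * (fval (sgn 1 1 t.2) + fval (sgn (-1) 1 t.2)
    - fval (sgn 1 (-1) t.2) - fval (sgn (-1) (-1) t.2))).sum ≠ 0 := by decide +kernel

def Lf (i : Fin 21) : ℤ × ℤ × ℤ := linL.getD i (0, 0, 0)
def crs (a b : ℤ × ℤ × ℤ) : ℤ × ℤ × ℤ :=
  (a.2.1 * b.2.2 - a.2.2 * b.2.1, a.2.2 * b.1 - a.1 * b.2.2, a.1 * b.2.1 - a.2.1 * b.1)

theorem pair_check : ∀ i j : Fin 21, i ≠ j → crs (Lf i) (Lf j) ≠ (0, 0, 0) ∧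
    ((∃ k : Fin 21, k ≠ i ∧ k ≠ j ∧ lval (Lf k) (crs (Lf i) (Lf j)) = 0) ∨
      ivalD gG (crs (Lf i) (Lf j)) = 0) := by decide +kernel

theorem reps_check : ∀ q ∈ reps, ∀ sx ∈ [(1 : ℤ), -1], ∀ sy ∈ [(1 : ℤ), -1],
    (q ≠ (0, 0, 0)) ∧ ∃ i j : Fin 21, i ≠ j ∧ lval (Lf i) (sgn sx sy q) = 0 ∧
      lval (Lf j) (sgn sx sy q) = 0 := by decide +kernel

noncomputable section

def pt (sx sy : ℤ) (q : ℕ × ℕ × ℕ) : Fin 3 → ℝ := ![(sx : ℝ) * q.1, (sy : ℝ) * q.2.1, (q.2.2 : ℝ)]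

def mono (m : ℕ × ℕ × ℕ) : PolyR := X 0 ^ m.1 * X 1 ^ m.2.1 * X 2 ^ m.2.2

def toPoly (D : List (ℤ × ℕ × ℕ × ℕ)) : PolyR := (D.map fun t => C (t.1 : ℝ) * mono t.2).sum

theorem eval_mono (sx sy : ℤ) (q m : ℕ × ℕ × ℕ) :
    eval (pt sx sy q) (mono m) = (sx : ℝ) ^ m.1 * (sy : ℝ) ^ m.2.1 * (mval m q : ℝ) := by
  have : mval m q = q.1 ^ m.1 * (q.2.1 ^ m.2.1 * q.2.2 ^ m.2.2) := rfl
  rw [this]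
  simp [mono, pt, mul_pow]
  ring

def evL (v : Fin 3 → ℝ) : PolyR →ₗ[ℝ] ℝ := (MvPolynomial.aeval v : PolyR →ₐ[ℝ] ℝ).toLinearMap

theorem evL_apply (v : Fin 3 → ℝ) (a : PolyR) : evL v a = eval v a := by
  simp [evL, MvPolynomial.coe_aeval_eq_eval]

/-- sign-twisted sum over the four sign changes -/
def E (px py : ℕ) (q : ℕ × ℕ × ℕ) : PolyR →ₗ[ℝ] ℝ :=
  evL (pt 1 1 q) + (-1 : ℝ) ^ px • evL (pt (-1) 1 q) + (-1 : ℝ) ^ py • evL (pt 1 (-1) q)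
    + ((-1 : ℝ) ^ px * (-1 : ℝ) ^ py) • evL (pt (-1) (-1) q)

theorem E_apply (px py : ℕ) (q : ℕ × ℕ × ℕ) (a : PolyR) : E px py q a =
    eval (pt 1 1 q) a + (-1 : ℝ) ^ px * eval (pt (-1) 1 q) a
      + (-1 : ℝ) ^ py * eval (pt 1 (-1) q) a
      + ((-1 : ℝ) ^ px * (-1 : ℝ) ^ py) * eval (pt (-1) (-1) q) a := by
  simp [E, evL_apply]

theorem E_mono (px py : ℕ) (q m : ℕ × ℕ × ℕ) : E px py q (mono m) =
    (1 + (-1 : ℝ) ^ (px + m.1)) * (1 + (-1 : ℝ) ^ (py + m.2.1)) * mval m q := by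
  rw [E_apply]; simp only [eval_mono]; push_cast; rw [pow_add, pow_add]; ring

theorem E_mono_same (px py : ℕ) (q m : ℕ × ℕ × ℕ) (h1 : m.1 % 2 = px % 2) (h2 : m.2.1 % 2 = py % 2) :
    E px py q (mono m) = 4 * mval m q := by
  have a1 : Even (px + m.1) := by rw [Nat.even_iff]; omega
  have a2 : Even (py + m.2.1) := by rw [Nat.even_iff]; omega
  rw [E_mono, a1.neg_one_pow, a2.neg_one_pow]; norm_num

theorem E_mono_diff (px py : ℕ) (q m : ℕ × ℕ × ℕ) (h : ¬ (m.1 % 2 = px % 2 ∧ m.2.1 % 2 = py % 2)) :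
    E px py q (mono m) = 0 := by
  rw [E_mono]
  by_cases h1 : m.1 % 2 = px % 2
  · have a2 : Odd (py + m.2.1) := by rw [Nat.odd_iff]; omega
    rw [a2.neg_one_pow]; ring
  · have a2 : Odd (px + m.1) := by rw [Nat.odd_iff]; omega
    rw [a2.neg_one_pow]; ring

theorem mem_cls (d px py : ℕ) (m : ℕ × ℕ × ℕ) : m ∈ cls d px py ↔
    m.1 + m.2.1 + m.2.2 = d ∧ m.1 % 2 = px ∧ m.2.1 % 2 = py := by
  obtain ⟨i, j, k⟩ := m
  simp only [cls, List.mem_flatMap, List.mem_range, List.mem_filterMap]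
  constructor
  · rintro ⟨i', hi, j', hj, h⟩
    split at h
    · rename_i hh
      simp only [Option.some.injEq, Prod.mk.injEq] at h
      obtain ⟨rfl, rfl, rfl⟩ := h
      exact ⟨by omega, hh.1, hh.2⟩
    · simp at h
  · rintro ⟨h1, h2, h3⟩
    refine ⟨i, by omega, j, by omega, ?_⟩
    rw [if_pos ⟨h2, h3⟩]
    simp; omega

def fs (m : ℕ × ℕ × ℕ) : Fin 3 →₀ ℕ :=
  Finsupp.single 0 m.1 + Finsupp.single 1 m.2.1 + Finsupp.single 2 m.2.2

theorem mono_eq (m : ℕ × ℕ × ℕ) (c : ℝ) : C c * mono m = monomial (fs m) c := by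
  rw [mono, fs, MvPolynomial.X_pow_eq_monomial, MvPolynomial.X_pow_eq_monomial,
    MvPolynomial.X_pow_eq_monomial, monomial_mul, monomial_mul, C_mul_monomial]
  simp

theorem fs_surj (s : Fin 3 →₀ ℕ) : fs (s 0, s 1, s 2) = s := by
  ext i; fin_cases i <;> simp [fs]

theorem fs_inj : Function.Injective fs := by
  intro a b h
  have h0 := DFunLike.congr_fun h 0
  have h1 := DFunLike.congr_fun h 1
  have h2 := DFunLike.congr_fun h 2
  simp [fs] at h0 h1 h2
  exact Prod.ext h0 (Prod.ext h1 h2)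

theorem mono_hom (m : ℕ × ℕ × ℕ) : (mono m).IsHomogeneous (m.1 + m.2.1 + m.2.2) := by
  unfold mono
  exact ((isHomogeneous_X_pow 0 _).mul (isHomogeneous_X_pow 1 _)).mul (isHomogeneous_X_pow 2 _)

def msAll (d : ℕ) : Finset (ℕ × ℕ × ℕ) :=
  (Finset.range (d + 1) ×ˢ (Finset.range (d + 1) ×ˢ Finset.range (d + 1))).filter
    fun m => m.1 + m.2.1 + m.2.2 = d

theorem mem_msAll (d : ℕ) (m : ℕ × ℕ × ℕ) : m ∈ msAll d ↔ m.1 + m.2.1 + m.2.2 = d := by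
  simp only [msAll, Finset.mem_filter, Finset.mem_product, Finset.mem_range]
  omega

theorem hom_decomp (d : ℕ) (a : PolyR) (ha : a.IsHomogeneous d) :
    a = ∑ m ∈ msAll d, C (coeff (fs m) a) * mono m := by
  simp only [mono_eq]
  have h1 : ∑ m ∈ msAll d, monomial (fs m) (coeff (fs m) a) =
      ∑ s ∈ (msAll d).map ⟨fs, fs_inj⟩, monomial s (coeff s a) := by
    rw [Finset.sum_map]; rfl
  rw [h1]
  conv_lhs => rw [a.as_sum]
  apply Finset.sum_subset
  · intro s hs
    rw [Finset.mem_map]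
    refine ⟨(s 0, s 1, s 2), ?_, fs_surj s⟩
    rw [mem_msAll]
    have := ha (mem_support_iff.1 hs)
    rw [← this, Finsupp.weight_apply, Finsupp.sum_fintype _ _ (by simp), Fin.sum_univ_three]
    simp
  · intro s _ hs
    rw [notMem_support_iff.1 hs]; simp

/-- the class part -/
def pc (c : ℕ × ℕ × ℕ → ℝ) (d px py : ℕ) : PolyR :=
  ((cls d px py).map fun m => C (c m) * mono m).sum

theorem class_decomp (d : ℕ) (a : PolyR) (ha : a.IsHomogeneous d)
    (nd : ∀ px < 2, ∀ py < 2, (cls d px py).Nodup) :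
    ∃ c : ℕ × ℕ × ℕ → ℝ, a = pc c d 0 0 + pc c d 0 1 + (pc c d 1 0 + pc c d 1 1) := by
  refine ⟨fun m => coeff (fs m) a, ?_⟩
  have key : ∀ px < 2, ∀ py < 2, pc (fun m => coeff (fs m) a) d px py =
      ∑ m ∈ ((msAll d).filter fun m => m.1 % 2 = px).filter (fun m => m.2.1 % 2 = py),
        C (coeff (fs m) a) * mono m := by
    intro px hpx py hpy
    unfold pc
    rw [← List.sum_toFinset _ (nd px hpx py hpy)]
    apply Finset.sum_congr _ (fun _ _ => rfl)
    ext m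
    simp only [List.mem_toFinset, mem_cls, Finset.mem_filter, mem_msAll, and_assoc]
  have e : ∀ (S : Finset (ℕ × ℕ × ℕ)) (p : ℕ × ℕ × ℕ → ℕ) (F : ℕ × ℕ × ℕ → PolyR),
      ∑ m ∈ S, F m = ∑ m ∈ S.filter (fun m => p m % 2 = 0), F m
        + ∑ m ∈ S.filter (fun m => p m % 2 = 1), F m := by
    intro S p F
    rw [← Finset.sum_filter_add_sum_filter_not S (fun m => p m % 2 = 0)]
    congr 2
    ext m; simp
  rw [key 0 (by norm_num) 0 (by norm_num), key 0 (by norm_num) 1 (by norm_num),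
    key 1 (by norm_num) 0 (by norm_num), key 1 (by norm_num) 1 (by norm_num)]
  rw [← e _ (fun m => m.2.1), ← e _ (fun m => m.2.1), ← e _ (fun m => m.1)]
  exact hom_decomp d a ha

theorem map_pc (ψ : PolyR →ₗ[ℝ] ℝ) (c : ℕ × ℕ × ℕ → ℝ) (d px py : ℕ) :
    ψ (pc c d px py) = ((cls d px py).map fun m => c m * ψ (mono m)).sum := by
  rw [pc, map_list_sum, List.map_map]
  congr 1
  apply List.map_congr_left
  intro m _
  simp [MvPolynomial.C_mul']

theorem map_toPoly (ψ : PolyR →ₗ[ℝ] ℝ) (D : List (ℤ × ℕ × ℕ × ℕ)) :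
    ψ (toPoly D) = (D.map fun t => (t.1 : ℝ) * ψ (mono t.2)).sum := by
  rw [toPoly, map_list_sum, List.map_map]
  congr 1
  apply List.map_congr_left
  intro m _
  simp only [Function.comp, MvPolynomial.C_mul', map_smul, smul_eq_mul]

theorem E_pc_same (c : ℕ × ℕ × ℕ → ℝ) (d px py : ℕ) (hx : px < 2) (hy : py < 2) (q : ℕ × ℕ × ℕ) :
    E px py q (pc c d px py) = 4 * ((cls d px py).map fun m => (mval m q : ℝ) * c m).sum := by
  rw [map_pc, ← List.sum_map_mul_left]
  congr 1
  apply List.map_congr_left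
  intro m hm
  rw [mem_cls] at hm
  rw [E_mono_same _ _ _ _ (by omega) (by omega)]; ring

theorem E_pc_diff (c : ℕ × ℕ × ℕ → ℝ) (d px py px' py' : ℕ) (hx : px < 2) (hy : py < 2)
    (hx' : px' < 2) (hy' : py' < 2) (h : ¬ (px' = px ∧ py' = py)) (q : ℕ × ℕ × ℕ) :
    E px py q (pc c d px' py') = 0 := by
  rw [map_pc]
  apply List.sum_eq_zero
  intro x hx
  obtain ⟨m, hm, rfl⟩ := List.mem_map.1 hx
  rw [mem_cls] at hm
  rw [E_mono_diff _ _ _ _ (by omega)]; ring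

theorem look_sum (l : List (ℕ × ℕ × ℕ)) (nd : l.Nodup) (D : List (ℤ × ℕ × ℕ × ℕ))
    (hD : ∀ t ∈ D, t.2 ∈ l) (F : ℕ × ℕ × ℕ → ℝ) :
    (l.map fun m => (look D m : ℝ) * F m).sum = (D.map fun t => (t.1 : ℝ) * F t.2).sum := by
  induction D with
  | nil => simp [look]
  | cons t D ih =>
    have h1 : ∀ m, (look (t :: D) m : ℝ) = (if t.2 = m then (t.1 : ℝ) else 0) + look D m := by
      intro m; simp only [look, List.map_cons, List.sum_cons]; push_cast; rfl
    simp only [h1, add_mul, List.sum_map_add, List.map_cons, List.sum_cons]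
    rw [ih (fun s hs => hD s (by simp [hs]))]
    congr 1
    rw [← List.sum_toFinset _ nd]
    simp only [ite_mul, zero_mul]
    rw [Finset.sum_ite_eq]
    rw [if_pos (by simpa using hD t (by simp))]

theorem dotR_ofFn {α : Type*} (Ds : List α) (f : α → ℤ) (t : Fin Ds.length → ℝ) :
    dotR (Ds.map f) (List.ofFn t) = ∑ j, (f (Ds.get j) : ℝ) * t j := by
  have h : Ds.map f = (List.finRange Ds.length).map fun j => f (Ds.get j) := by
    apply List.ext_get <;> simp
  rw [h, List.ofFn_eq_map, dotR_map_map, ← Fin.sum_univ_def]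

theorem span_class (d px py : ℕ) (hx : px < 2) (hy : py < 2)
    (Ds : List (List (ℤ × ℕ × ℕ × ℕ))) (fr : List (ℕ × ℕ × ℕ))
    (hc : spanCheck d px py Ds fr = true) (nd : (cls d px py).Nodup)
    (c : ℕ × ℕ × ℕ → ℝ)
    (h0 : ∀ q ∈ reps, ((cls d px py).map fun m => (mval m q : ℝ) * c m).sum = 0)
    (ψ : PolyR →ₗ[ℝ] ℝ) (hψ : ∀ D ∈ Ds, ψ (toPoly D) = 0) : ψ (pc c d px py) = 0 := by
  simp only [spanCheck, Bool.and_eq_true, decide_eq_true_eq, List.all_eq_true] at hc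
  obtain ⟨⟨⟨⟨hlen, he1⟩, hsub⟩, hval⟩, he2⟩ := hc
  -- solve for the coefficients
  let T : (Fin Ds.length → ℝ) →ₗ[ℝ] (Fin Ds.length → ℝ) :=
    Matrix.toLin' (Matrix.of fun i j => ((look (Ds.get j) (fr.get (i.cast hlen)) : ℤ) : ℝ))
  have hT : ∀ t i, T t i = ∑ j, ((look (Ds.get j) (fr.get (i.cast hlen)) : ℤ) : ℝ) * t j := by
    intro t i
    simp [T, Matrix.toLin'_apply, Matrix.mulVec, dotProduct]
  have hinj : Function.Injective T := by
    rw [injective_iff_map_eq_zero]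
    intro t ht
    have hz := elim_sound Ds.length (frRows Ds fr) (List.ofFn t) (by simp) (by
      intro r hr
      obtain ⟨f, hf, rfl⟩ := List.mem_map.1 hr
      obtain ⟨i, hi⟩ := List.get_of_mem hf
      rw [dotR_ofFn Ds (fun D => look D f) t]
      have := congrFun ht (i.cast hlen.symm)
      rw [hT] at this
      simpa [← hi] using this) he1
    funext j
    exact hz (t j) (by simp)
  have hsurj := LinearMap.injective_iff_surjective.1 hinj
  obtain ⟨t, ht⟩ := hsurj (fun i => c (fr.get (i.cast hlen)))
  set c' : ℕ × ℕ × ℕ → ℝ := fun m => c m - ∑ j, t j * (look (Ds.get j) m : ℝ) with hc'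
  have hlook : ∀ (j : Fin Ds.length) (F : ℕ × ℕ × ℕ → ℝ),
      ((cls d px py).map fun m => (look (Ds.get j) m : ℝ) * F m).sum =
        ((Ds.get j).map fun t => (t.1 : ℝ) * F t.2).sum := fun j F =>
    look_sum _ nd _ (fun s hs => hsub _ (List.get_mem Ds j) s hs) F
  have hexp : ∀ F : ℕ × ℕ × ℕ → ℝ, ((cls d px py).map fun m => F m * c' m).sum =
      ((cls d px py).map fun m => F m * c m).sum -
        ∑ j, t j * ((Ds.get j).map fun t => (t.1 : ℝ) * F t.2).sum := by
    intro F
    simp only [← hlook]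
    simp only [← List.sum_toFinset _ nd]
    simp only [Finset.mul_sum]
    rw [Finset.sum_comm, ← Finset.sum_sub_distrib]
    apply Finset.sum_congr rfl
    intro m _
    simp only [hc', mul_sub, Finset.mul_sum]
    congr 1
    apply Finset.sum_congr rfl
    intro j _; ring
  have hz := elim_sound _ _ ((cls d px py).map c') (by simp) (by
    intro r hr
    rcases List.mem_append.1 hr with hr | hr
    · obtain ⟨f, hf, rfl⟩ := List.mem_map.1 hr
      rw [dotR_map_map]
      apply List.sum_eq_zero
      intro x hx
      obtain ⟨m, hm, rfl⟩ := List.mem_map.1 hx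
      by_cases hmf : m = f
      · obtain ⟨i, hi⟩ := List.get_of_mem hf
        have := congrFun ht (i.cast hlen.symm)
        rw [hT] at this
        simp only [Fin.cast_cast, Fin.cast_eq_self, hi] at this
        have h2 : c' m = 0 := by
          rw [hc', hmf]
          simp only
          rw [← this, sub_eq_zero]
          apply Finset.sum_congr rfl
          intro j _; ring
        rw [h2]; ring
      · simp [hmf]
    · obtain ⟨q, hq, rfl⟩ := List.mem_map.1 hr
      rw [dotR_map_map]
      simp only [Int.cast_natCast]
      rw [hexp (fun m => (mval m q : ℝ)), h0 q hq, zero_sub, neg_eq_zero]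
      apply Finset.sum_eq_zero
      intro j _
      have := hval _ (List.get_mem Ds j) q hq
      have h3 : ((dval (Ds.get j) q : ℤ) : ℝ) = 0 := by rw [this]; simp
      rw [dval, Int.cast_list_sum, List.map_map] at h3
      have h4 : (fun t : ℤ × ℕ × ℕ × ℕ => (t.1 : ℝ) * (mval t.2 q : ℝ)) =
        (Int.cast ∘ fun t : ℤ × ℕ × ℕ × ℕ => t.1 * (mval t.2 q : ℤ)) := by
        funext t; simp
      rw [h4, h3, mul_zero]) he2
  have hz' : ∀ m ∈ cls d px py, c' m = 0 := fun m hm => hz _ (List.mem_map.2 ⟨m, hm, rfl⟩)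
  have hfin := hexp (fun m => ψ (mono m))
  have hl : ((cls d px py).map fun m => ψ (mono m) * c' m).sum = 0 := by
    apply List.sum_eq_zero
    intro x hx
    obtain ⟨m, hm, rfl⟩ := List.mem_map.1 hx
    rw [hz' m hm, mul_zero]
  rw [hl] at hfin
  have hr : ∑ j, t j * ((Ds.get j).map fun t => (t.1 : ℝ) * ψ (mono t.2)).sum = 0 := by
    apply Finset.sum_eq_zero
    intro j _
    rw [← map_toPoly, hψ _ (List.get_mem Ds j), mul_zero]
  rw [hr, sub_zero] at hfin
  rw [map_pc, hfin]
  congr 1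
  apply List.map_congr_left
  intro m _; ring

end

noncomputable section

theorem lsum_exists (l : List (ℤ × ℕ × ℕ × ℕ)) (px py : ℕ) :
    ∃ Ψ : PolyR →ₗ[ℝ] ℝ, ∀ a, Ψ a = (l.map fun t => (t.1 : ℝ) * E px py t.2 a).sum := by
  induction l with
  | nil => exact ⟨0, by simp⟩
  | cons t l ih =>
    obtain ⟨Ψ, h⟩ := ih
    exact ⟨(t.1 : ℝ) • E px py t.2 + Ψ, fun a => by simp [h]⟩

def lsum (l : List (ℤ × ℕ × ℕ × ℕ)) (px py : ℕ) : PolyR →ₗ[ℝ] ℝ := (lsum_exists l px py).choose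

theorem lsum_apply (l : List (ℤ × ℕ × ℕ × ℕ)) (px py : ℕ) (a : PolyR) :
    lsum l px py a = (l.map fun t => (t.1 : ℝ) * E px py t.2 a).sum :=
  (lsum_exists l px py).choose_spec a

theorem annih_sound (d px py : ℕ) (hx : px < 2) (hy : py < 2) (l : List (ℤ × ℕ × ℕ × ℕ))
    (h : annih d px py l = true) (b : PolyR) (hb : b.IsHomogeneous d) :
    (l.map fun t => (t.1 : ℝ) * E px py t.2 b).sum = 0 := by
  rw [← lsum_apply, hom_decomp d b hb, map_sum]
  apply Finset.sum_eq_zero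
  intro m hm
  rw [mem_msAll] at hm
  rw [MvPolynomial.C_mul', map_smul, lsum_apply]
  simp only [annih, List.all_eq_true, decide_eq_true_eq] at h
  by_cases hp : m.1 % 2 = px % 2 ∧ m.2.1 % 2 = py % 2
  · have h1 := h m ((mem_cls _ _ _ _).2 ⟨hm, by omega, by omega⟩)
    have h2 : ((l.map fun t => t.1 * (mval m t.2 : ℤ)).sum : ℝ) = 0 := by exact_mod_cast h1
    simp only [E_mono_same px py _ m hp.1 hp.2]
    have h3 : (l.map fun t => (t.1 : ℝ) * (4 * (mval m t.2 : ℝ))).sum =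
        4 * (l.map fun t => (t.1 : ℝ) * (mval m t.2 : ℝ)).sum := by
      rw [← List.sum_map_mul_left]
      congr 1
      apply List.map_congr_left
      intro t _; ring
    rw [h3]
    rw [Int.cast_list_sum, List.map_map] at h2
    have h4 : (fun t : ℤ × ℕ × ℕ × ℕ => (t.1 : ℝ) * (mval m t.2 : ℝ)) =
        (Int.cast ∘ fun t : ℤ × ℕ × ℕ × ℕ => t.1 * (mval m t.2 : ℤ)) := by
      funext t; simp
    rw [h4, h2]; simp
  · simp only [E_mono_diff px py _ m hp]
    simp

theorem sgn_pow_mod (s : ℤ) (hs : s ∈ [(1 : ℤ), -1]) (n p : ℕ) (h : n % 2 = p) :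
    (s : ℝ) ^ n = (s : ℝ) ^ p := by
  simp only [List.mem_cons, List.not_mem_nil, or_false] at hs
  rcases hs with rfl | rfl
  · simp
  · push_cast; rw [neg_one_pow_eq_pow_mod_two, h]

theorem eval_toPoly (D : List (ℤ × ℕ × ℕ × ℕ)) (px py : ℕ)
    (hD : ∀ t ∈ D, t.2.1 % 2 = px ∧ t.2.2.1 % 2 = py) (sx sy : ℤ) (hsx : sx ∈ [(1 : ℤ), -1])
    (hsy : sy ∈ [(1 : ℤ), -1]) (q : ℕ × ℕ × ℕ) :
    eval (pt sx sy q) (toPoly D) = (sx : ℝ) ^ px * (sy : ℝ) ^ py * (dval D q : ℝ) := by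
  rw [← evL_apply, map_toPoly, dval, Int.cast_list_sum, List.map_map, ← List.sum_map_mul_left]
  congr 1
  apply List.map_congr_left
  intro t ht
  rw [evL_apply, eval_mono, sgn_pow_mod sx hsx _ _ (hD t ht).1, sgn_pow_mod sy hsy _ _ (hD t ht).2]
  simp; ring

theorem E_mul (D : List (ℤ × ℕ × ℕ × ℕ)) (px py : ℕ) (hy : py < 2)
    (hD : ∀ t ∈ D, t.2.1 % 2 = px ∧ t.2.2.1 % 2 = py) (q : ℕ × ℕ × ℕ) (b : PolyR) :
    E 0 1 q (toPoly D * b) = (dval D q : ℝ) * E px (1 - py) q b := by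
  rw [E_apply, E_apply]
  simp only [map_mul]
  rw [eval_toPoly D px py hD 1 1 (by simp) (by simp), eval_toPoly D px py hD (-1) 1 (by simp) (by simp),
    eval_toPoly D px py hD 1 (-1) (by simp) (by simp),
    eval_toPoly D px py hD (-1) (-1) (by simp) (by simp)]
  have : (-1 : ℝ) ^ (1 - py) = - (-1) ^ py := by interval_cases py <;> simp
  rw [this]
  push_cast
  simp only [one_pow]
  ring

def phi0 : PolyR →ₗ[ℝ] ℝ := lsum wQ 0 1

def Van (a : PolyR) : Prop := ∀ q ∈ reps, ∀ sx ∈ [(1 : ℤ), -1], ∀ sy ∈ [(1 : ℤ), -1],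
  eval (pt sx sy q) a = 0

theorem Van.E_zero {a : PolyR} (h : Van a) (px py : ℕ) (q : ℕ × ℕ × ℕ) (hq : q ∈ reps) :
    E px py q a = 0 := by
  rw [E_apply, h q hq 1 (by simp) 1 (by simp), h q hq 1 (by simp) (-1) (by simp),
    h q hq (-1) (by simp) 1 (by simp), h q hq (-1) (by simp) (-1) (by simp)]
  simp

theorem Van.mul {a : PolyR} (h : Van a) (c : PolyR) : Van (c * a) := by
  intro q hq sx hsx sy hsy
  rw [map_mul, h q hq sx hsx sy hsy, mul_zero]

theorem lam_sound (d px py : ℕ) (hx : px < 2) (hy : py < 2) (D lam : List (ℤ × ℕ × ℕ × ℕ))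
    (hc : lamCheck d px py D lam = true) (b : PolyR) (hb : b.IsHomogeneous d) (hv : Van b) :
    phi0 (toPoly D * b) = 0 := by
  simp only [lamCheck, Bool.and_eq_true, List.all_eq_true, decide_eq_true_eq] at hc
  obtain ⟨⟨h1, h2⟩, h3⟩ := hc
  have h4 := annih_sound d px (1 - py) hx (by omega) _ h3 b hb
  rw [List.map_append, List.sum_append, List.map_map, List.map_map] at h4
  have h5 : (lam.map ((fun t : ℤ × ℕ × ℕ × ℕ => (t.1 : ℝ) * E px (1 - py) t.2 b) ∘
      fun t => (-t.1, t.2))).sum = 0 := by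
    apply List.sum_eq_zero
    intro x hx
    obtain ⟨t, ht, rfl⟩ := List.mem_map.1 hx
    simp only [Function.comp]
    rw [hv.E_zero _ _ _ (h2 t ht), mul_zero]
  rw [h5, add_zero] at h4
  rw [phi0, lsum_apply, ← h4]
  congr 1
  apply List.map_congr_left
  intro t _
  simp only [Function.comp]
  rw [E_mul D px py hy h1]
  push_cast; ring

theorem span_all (d : ℕ) (nd : ∀ px < 2, ∀ py < 2, (cls d px py).Nodup)
    (D1 D2 D3 D4 : List (List (ℤ × ℕ × ℕ × ℕ))) (f1 f2 f3 f4 : List (ℕ × ℕ × ℕ))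
    (c1 : spanCheck d 0 0 D1 f1 = true) (c2 : spanCheck d 0 1 D2 f2 = true)
    (c3 : spanCheck d 1 0 D3 f3 = true) (c4 : spanCheck d 1 1 D4 f4 = true)
    (a : PolyR) (ha : a.IsHomogeneous d) (hv : Van a)
    (ψ : PolyR →ₗ[ℝ] ℝ) (h1 : ∀ D ∈ D1, ψ (toPoly D) = 0) (h2 : ∀ D ∈ D2, ψ (toPoly D) = 0)
    (h3 : ∀ D ∈ D3, ψ (toPoly D) = 0) (h4 : ∀ D ∈ D4, ψ (toPoly D) = 0) : ψ a = 0 := by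
  obtain ⟨c, hc⟩ := class_decomp d a ha nd
  have key : ∀ px < 2, ∀ py < 2, ∀ q ∈ reps,
      ((cls d px py).map fun m => (mval m q : ℝ) * c m).sum = 0 := by
    intro px hx py hy q hq
    have h := hv.E_zero px py q hq
    have hs := E_pc_same c d px py hx hy q
    have e : ∀ px' < 2, ∀ py' < 2, ¬ (px' = px ∧ py' = py) → E px py q (pc c d px' py') = 0 :=
      fun px' hx' py' hy' hne => E_pc_diff c d px py px' py' hx hy hx' hy' hne q
    have h' : E px py q (pc c d px py) = 0 := by
      rw [hc] at h
      simp only [map_add] at h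
      interval_cases px <;> interval_cases py
      · rw [e 0 (by norm_num) 1 (by norm_num) (by norm_num), e 1 (by norm_num) 0 (by norm_num) (by norm_num),
          e 1 (by norm_num) 1 (by norm_num) (by norm_num)] at h
        simpa using h
      · rw [e 0 (by norm_num) 0 (by norm_num) (by norm_num), e 1 (by norm_num) 0 (by norm_num) (by norm_num),
          e 1 (by norm_num) 1 (by norm_num) (by norm_num)] at h
        simpa using h
      · rw [e 0 (by norm_num) 1 (by norm_num) (by norm_num), e 0 (by norm_num) 0 (by norm_num) (by norm_num),
          e 1 (by norm_num) 1 (by norm_num) (by norm_num)] at h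
        simpa using h
      · rw [e 0 (by norm_num) 1 (by norm_num) (by norm_num), e 1 (by norm_num) 0 (by norm_num) (by norm_num),
          e 0 (by norm_num) 0 (by norm_num) (by norm_num)] at h
        simpa using h
    rw [hs] at h'
    linarith
  have z : 0 < 2 := by norm_num
  have o : 1 < 2 := by norm_num
  rw [hc]
  simp only [map_add]
  rw [span_class d 0 0 z z D1 f1 c1 (nd 0 z 0 z) c (key 0 z 0 z) ψ h1,
    span_class d 0 1 z o D2 f2 c2 (nd 0 z 1 o) c (key 0 z 1 o) ψ h2,
    span_class d 1 0 o z D3 f3 c3 (nd 1 o 0 z) c (key 1 o 0 z) ψ h3,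
    span_class d 1 1 o o D4 f4 c4 (nd 1 o 1 o) c (key 1 o 1 o) ψ h4]
  simp

theorem nd13 : ∀ px < 2, ∀ py < 2, (cls 13 px py).Nodup := by decide +kernel
theorem nd14 : ∀ px < 2, ∀ py < 2, (cls 14 px py).Nodup := by decide +kernel
theorem nd15 : ∀ px < 2, ∀ py < 2, (cls 15 px py).Nodup := by decide +kernel

theorem van13 (a : PolyR) (ha : a.IsHomogeneous 13) (hv : Van a) : a = 0 := by
  ext s
  have := span_all 13 nd13 [] [] [] [] [] [] [] [] span13a span13b span13c span13d a ha hv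
    (MvPolynomial.lcoeff ℝ s) (by simp) (by simp) (by simp) (by simp)
  simpa using this

theorem van_low (d : ℕ) (hd : d ≤ 13) (a : PolyR) (ha : a.IsHomogeneous d) (hv : Van a) : a = 0 := by
  have h1 : (X 2 ^ (13 - d) * a : PolyR).IsHomogeneous 13 := by
    have := (isHomogeneous_X_pow (R := ℝ) (2 : Fin 3) (13 - d)).mul ha
    rwa [show 13 - d + d = 13 by omega] at this
  have := van13 _ h1 (hv.mul _)
  rcases mul_eq_zero.1 this with h | h
  · exact absurd h (pow_ne_zero _ (X_ne_zero _))
  · exact h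

theorem kill_gens (b : PolyR) (hb : b.IsHomogeneous 17) (hv : Van b) :
    ∀ D ∈ [g1, g2, g3, g4, g5, g6, g7], phi0 (toPoly D * b) = 0 := by
  have z : 0 < 2 := by norm_num
  have o : 1 < 2 := by norm_num
  intro D hD
  simp only [List.mem_cons, List.not_mem_nil, or_false] at hD
  rcases hD with rfl | rfl | rfl | rfl | rfl | rfl | rfl
  · exact lam_sound 17 0 0 z z _ _ lc1 b hb hv
  · exact lam_sound 17 0 1 z o _ _ lc2 b hb hv
  · exact lam_sound 17 0 1 z o _ _ lc3 b hb hv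
  · exact lam_sound 17 1 0 o z _ _ lc4 b hb hv
  · exact lam_sound 17 1 1 o o _ _ lc5 b hb hv
  · exact lam_sound 17 1 1 o o _ _ lc6 b hb hv
  · exact lam_sound 17 1 1 o o _ _ lc7 b hb hv

def psi (b : PolyR) : PolyR →ₗ[ℝ] ℝ := phi0 ∘ₗ LinearMap.mulRight ℝ b

theorem psi_apply (a b : PolyR) : psi b a = phi0 (a * b) := rfl

theorem kill14 (a b : PolyR) (ha : a.IsHomogeneous 14) (hva : Van a) (hb : b.IsHomogeneous 17)
    (hv : Van b) : phi0 (a * b) = 0 := by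
  have k := kill_gens b hb hv
  simp only [← psi_apply] at k ⊢
  apply span_all 14 nd14 _ _ _ _ _ _ _ _ span14a span14b span14c span14d a ha hva (psi b)
  all_goals
    intro D hD
    apply k D
    simp only [List.mem_cons, List.not_mem_nil, or_false] at hD ⊢
    tauto

theorem toPoly_shx (D : List (ℤ × ℕ × ℕ × ℕ)) : toPoly (shx D) = toPoly D * X 0 := by
  rw [toPoly, toPoly, shx, List.map_map, ← List.sum_map_mul_right]
  congr 1
  apply List.map_congr_left
  intro t _
  simp only [Function.comp, mono]; ring

theorem toPoly_shy (D : List (ℤ × ℕ × ℕ × ℕ)) : toPoly (shy D) = toPoly D * X 1 := by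
  rw [toPoly, toPoly, shy, List.map_map, ← List.sum_map_mul_right]
  congr 1
  apply List.map_congr_left
  intro t _
  simp only [Function.comp, mono]; ring

theorem toPoly_shz (D : List (ℤ × ℕ × ℕ × ℕ)) : toPoly (shz D) = toPoly D * X 2 := by
  rw [toPoly, toPoly, shz, List.map_map, ← List.sum_map_mul_right]
  congr 1
  apply List.map_congr_left
  intro t _
  simp only [Function.comp, mono]; ring

theorem kill15 (a b : PolyR) (ha : a.IsHomogeneous 15) (hva : Van a) (hb : b.IsHomogeneous 16)
    (hv : Van b) : phi0 (a * b) = 0 := by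
  have hX : ∀ i : Fin 3, (X i * b : PolyR).IsHomogeneous 17 := fun i => by
    have := (isHomogeneous_X ℝ i).mul hb
    rwa [show 1 + 16 = 17 from rfl] at this
  have k := fun i => kill_gens (X i * b) (hX i) (hv.mul _)
  have kx : ∀ D ∈ [g1, g2, g3, g4, g5, g6, g7], psi b (toPoly (shx D)) = 0 := fun D hD => by
    rw [psi_apply, toPoly_shx, mul_assoc]; exact k 0 D hD
  have ky : ∀ D ∈ [g1, g2, g3, g4, g5, g6, g7], psi b (toPoly (shy D)) = 0 := fun D hD => by
    rw [psi_apply, toPoly_shy, mul_assoc]; exact k 1 D hD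
  have kz : ∀ D ∈ [g1, g2, g3, g4, g5, g6, g7], psi b (toPoly (shz D)) = 0 := fun D hD => by
    rw [psi_apply, toPoly_shz, mul_assoc]; exact k 2 D hD
  have kh : psi b (toPoly gh) = 0 := lam_sound 16 0 1 (by norm_num) (by norm_num) _ _ lch b hb hv
  simp only [List.forall_mem_cons] at kx ky kz
  rw [← psi_apply]
  apply span_all 15 nd15 _ _ _ _ _ _ _ _ span15a span15b span15c span15d a ha hva (psi b)
  all_goals
    simp only [List.forall_mem_cons]
    simp [kx, ky, kz, kh]

/-- vanishing on the lines through the (rescaled) points -/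
def KI : Ideal PolyR where
  carrier := {f | ∀ q ∈ reps, ∀ sx ∈ [(1 : ℤ), -1], ∀ sy ∈ [(1 : ℤ), -1], ∀ c : ℝ,
    eval (c • pt sx sy q) f = 0}
  zero_mem' := by intro q _ sx _ sy _ c; simp
  add_mem' := by
    intro a b ha hb q hq sx hx sy hy c
    rw [map_add, ha q hq sx hx sy hy c, hb q hq sx hx sy hy c, add_zero]
  smul_mem' := by
    intro a f hf q hq sx hx sy hy c
    rw [smul_eq_mul, map_mul, hf q hq sx hx sy hy c, mul_zero]

theorem hom_eval_smul (d : ℕ) (a : PolyR) (ha : a.IsHomogeneous d) (c : ℝ) (v : Fin 3 → ℝ) :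
    eval (c • v) a = c ^ d * eval v a := by
  rw [hom_decomp d a ha]
  simp only [map_sum, Finset.mul_sum]
  apply Finset.sum_congr rfl
  intro m hm
  rw [mem_msAll] at hm
  simp only [mono, map_mul, map_pow, eval_C, eval_X, Pi.smul_apply, smul_eq_mul, ← hm, mul_pow, pow_add]
  ring

theorem comp_vanish (a : PolyR) (v : Fin 3 → ℝ) (h : ∀ c : ℝ, eval (c • v) a = 0) (d : ℕ) :
    eval v (homogeneousComponent d a) = 0 := by
  by_cases hd : d < a.totalDegree + 1
  · let p : Polynomial ℝ := ∑ i ∈ Finset.range (a.totalDegree + 1),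
      Polynomial.C (eval v (homogeneousComponent i a)) * Polynomial.X ^ i
    have hp : p = 0 := by
      apply Polynomial.funext
      intro c
      simp only [p, Polynomial.eval_finset_sum, Polynomial.eval_mul, Polynomial.eval_C,
        Polynomial.eval_pow, Polynomial.eval_X, Polynomial.eval_zero]
      have h1 := h c
      rw [← sum_homogeneousComponent a, map_sum] at h1
      rw [← h1]
      apply Finset.sum_congr rfl
      intro i _
      rw [hom_eval_smul i _ (homogeneousComponent_isHomogeneous i a)]; ring
    have := congrArg (fun r => Polynomial.coeff r d) hp
    simp only [p, Polynomial.finset_sum_coeff, Polynomial.coeff_C_mul, Polynomial.coeff_X_pow,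
      Polynomial.coeff_zero] at this
    simpa [hd] using this
  · rw [homogeneousComponent_eq_zero _ _ (by omega)]; simp

theorem KI_van (a : PolyR) (ha : a ∈ KI) (d : ℕ) : Van (homogeneousComponent d a) :=
  fun q hq sx hx sy hy => comp_vanish a _ (ha q hq sx hx sy hy) d

def phi : PolyR →ₗ[ℝ] ℝ := phi0 ∘ₗ homogeneousComponent 31

theorem phi_mul (a b : PolyR) (ha : a ∈ KI) (hb : b ∈ KI) : phi (a * b) = 0 := by
  rw [← sum_homogeneousComponent a, ← sum_homogeneousComponent b, Finset.sum_mul_sum, map_sum]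
  apply Finset.sum_eq_zero
  intro d _
  rw [map_sum]
  apply Finset.sum_eq_zero
  intro e _
  have hda := homogeneousComponent_isHomogeneous d a
  have heb := homogeneousComponent_isHomogeneous e b
  have hva := KI_van a ha d
  have hvb := KI_van b hb e
  generalize homogeneousComponent d a = A at *
  generalize homogeneousComponent e b = B at *
  have hAB : A * B ∈ homogeneousSubmodule (Fin 3) ℝ (d + e) := hda.mul heb
  rw [phi, LinearMap.comp_apply, homogeneousComponent_of_mem hAB]
  split
  · rename_i hde
    by_cases h1 : d ≤ 13
    · rw [van_low d h1 A hda hva]; simp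
    by_cases h2 : e ≤ 13
    · rw [van_low e h2 B heb hvb]; simp
    have : d = 14 ∨ d = 15 ∨ d = 16 ∨ d = 17 := by omega
    rcases this with rfl | rfl | rfl | rfl
    · obtain rfl : e = 17 := by omega
      exact kill14 A B hda hva heb hvb
    · obtain rfl : e = 16 := by omega
      exact kill15 A B hda hva heb hvb
    · obtain rfl : e = 15 := by omega
      rw [mul_comm]
      exact kill15 B A heb hvb hda hva
    · obtain rfl : e = 14 := by omega
      rw [mul_comm]
      exact kill14 B A heb hvb hda hva
  · simp

theorem phi_sq (f : PolyR) (hf : f ∈ KI ^ 2) : phi f = 0 := by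
  rw [pow_two] at hf
  induction hf using Submodule.mul_induction_on' with
  | mem_mul_mem a ha b hb => exact phi_mul a b ha hb
  | add x _ y _ h1 h2 => rw [map_add, h1, h2, add_zero]

end

noncomputable section

theorem u_sq : u * u = 3 / 4 := by
  have h := Real.mul_self_sqrt (show (0 : ℝ) ≤ 3 by norm_num)
  unfold u; linarith

theorem u_ne : u ≠ 0 := by
  intro h
  have := u_sq
  rw [h] at this; norm_num at this

theorem rotA_inv : rotA⁻¹ = !![1/2, u, 0; -u, 1/2, 0; 0, 0, 1] := by
  apply Matrix.inv_eq_right_inv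
  have h := u_sq
  ext i j
  fin_cases i <;> fin_cases j <;> simp [rotA, Matrix.mul_apply, Fin.sum_univ_three] <;> linarith

theorem rotA_sq_inv : (rotA ^ 2)⁻¹ = !![-1/2, u, 0; -u, -1/2, 0; 0, 0, 1] := by
  apply Matrix.inv_eq_right_inv
  have h := u_sq
  have h2 : rotA ^ 2 = !![-1/2, -u, 0; u, -1/2, 0; 0, 0, 1] := by
    ext i j
    fin_cases i <;> fin_cases j <;>
      simp [rotA, pow_two, Matrix.mul_apply, Fin.sum_univ_three] <;> linarith
  rw [h2]
  ext i j
  fin_cases i <;> fin_cases j <;> simp [Matrix.mul_apply, Fin.sum_univ_three] <;> linarith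

theorem eval_substMat (M : Matrix (Fin 3) (Fin 3) ℝ) (v : Fin 3 → ℝ) (p : PolyR) :
    eval v (substMat M p) = eval (M.mulVec v) p := by
  have : (eval v).comp (substMat M : PolyR →+* PolyR) = eval (M.mulVec v) := by
    apply MvPolynomial.ringHom_ext
    · intro r; simp [substMat]
    · intro i; simp [substMat, Matrix.mulVec, dotProduct]
  exact congrArg (fun g => g p) this

def lr (l : ℤ × ℤ × ℤ) (V : Fin 3 → ℝ) : ℝ := (l.1 : ℝ) * V 0 + l.2.1 * V 1 + l.2.2 * V 2

def sc (r : ℝ) (v : Fin 3 → ℝ) : Fin 3 → ℝ := ![r * v 0, v 1, v 2]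

theorem line_eval (i : Fin 21) : ∃ κ : ℝ, κ ≠ 0 ∧ ∀ V : Fin 3 → ℝ,
    eval (sc u V) (linesB21 i) = κ * lr (Lf i) V := by
  have hu := u_ne
  have h := u_sq
  have hx1 : u / 2 ≠ 0 := by simpa using hu
  have hx2 : -(u / 2) ≠ 0 := by simpa using hu
  have hy : (-1 / 4 : ℝ) ≠ 0 := by norm_num
  have e0 : ∀ V : Fin 3 → ℝ, sc u V 0 = u * V 0 := fun _ => rfl
  have e1 : ∀ V : Fin 3 → ℝ, sc u V 1 = V 1 := fun _ => rfl
  have e2 : ∀ V : Fin 3 → ℝ, sc u V 2 = V 2 := fun _ => rfl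
  fin_cases i
  iterate 4
    focus
      refine ⟨u, hu, fun V => ?_⟩
      simp [linesB21, baseFormsB, lr, Lf, linL, e0, e1, e2]
      try ring_nf
  iterate 3
    focus
      refine ⟨1, one_ne_zero, fun V => ?_⟩
      simp [linesB21, baseFormsB, lr, Lf, linL, e0, e1, e2]
      try ring_nf
  iterate 4
    focus
      refine ⟨u / 2, hx1, fun V => ?_⟩
      simp [linesB21, baseFormsB, lr, Lf, linL, eval_substMat, rotA_inv, Matrix.mulVec, dotProduct,
        Fin.sum_univ_three, e0, e1, e2]
      ring
  iterate 3
    focus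
      refine ⟨-1 / 4, hy, fun V => ?_⟩
      simp [linesB21, baseFormsB, lr, Lf, linL, eval_substMat, rotA_inv, Matrix.mulVec, dotProduct,
        Fin.sum_univ_three, e0, e1, e2]
      linear_combination (-V 0) * h
  iterate 4
    focus
      refine ⟨-(u / 2), hx2, fun V => ?_⟩
      simp [linesB21, baseFormsB, lr, Lf, linL, eval_substMat, rotA_sq_inv, Matrix.mulVec, dotProduct,
        Fin.sum_univ_three, e0, e1, e2]
      ring
  iterate 3
    focus
      refine ⟨-1 / 4, hy, fun V => ?_⟩
      simp [linesB21, baseFormsB, lr, Lf, linL, eval_substMat, rotA_sq_inv, Matrix.mulVec, dotProduct,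
        Fin.sum_univ_three, e0, e1, e2]
      linear_combination (-V 0) * h

theorem sc_sc (v : Fin 3 → ℝ) : sc u (sc u⁻¹ v) = v := by
  ext i; fin_cases i <;> simp [sc, u_ne]

theorem sc_smul (r c : ℝ) (v : Fin 3 → ℝ) : sc r (c • v) = c • sc r v := by
  ext i; fin_cases i <;> simp [sc]; ring

def SX (r : ℝ) : PolyR →ₐ[ℝ] PolyR := MvPolynomial.aeval ![C r * X 0, X 1, X 2]

theorem eval_SX (r : ℝ) (v : Fin 3 → ℝ) (p : PolyR) : eval v (SX r p) = eval (sc r v) p := by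
  have : (eval v).comp (SX r : PolyR →+* PolyR) = eval (sc r v) := by
    apply MvPolynomial.ringHom_ext
    · intro c; simp [SX]
    · intro i; fin_cases i <;> simp [SX, sc]
  exact congrArg (fun g => g p) this

def kap (i : Fin 21) : ℝ := (line_eval i).choose
theorem kap_ne (i : Fin 21) : kap i ≠ 0 := (line_eval i).choose_spec.1
theorem line_ev (i : Fin 21) (V : Fin 3 → ℝ) : eval (sc u V) (linesB21 i) = kap i * lr (Lf i) V :=
  (line_eval i).choose_spec.2 V

theorem line_ev' (i : Fin 21) (v : Fin 3 → ℝ) :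
    eval v (linesB21 i) = kap i * lr (Lf i) (sc u⁻¹ v) := by
  rw [← line_ev, sc_sc]

theorem line_zero (i : Fin 21) (v : Fin 3 → ℝ) :
    eval v (linesB21 i) = 0 ↔ lr (Lf i) (sc u⁻¹ v) = 0 := by
  rw [line_ev', mul_eq_zero, or_iff_right (kap_ne i)]

theorem lr_smul (l : ℤ × ℤ × ℤ) (c : ℝ) (V : Fin 3 → ℝ) : lr l (c • V) = c * lr l V := by
  simp [lr]; ring

def linP (l : ℤ × ℤ × ℤ) : PolyR :=
  C (l.1 : ℝ) * X 0 + C (l.2.1 : ℝ) * X 1 + C (l.2.2 : ℝ) * X 2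

theorem linP_hom (l : ℤ × ℤ × ℤ) : (linP l).IsHomogeneous 1 := by
  unfold linP
  have h : ∀ (c : ℝ) (i : Fin 3), (C c * X i : PolyR).IsHomogeneous 1 := fun c i => by
    simpa using (isHomogeneous_C (Fin 3) c).mul (isHomogeneous_X ℝ i)
  exact ((h _ _).add (h _ _)).add (h _ _)

theorem eval_linP (l : ℤ × ℤ × ℤ) (V : Fin 3 → ℝ) : eval V (linP l) = lr l V := by
  simp [linP, lr]

def theF : PolyR := (∏ i, linesB21 i) * SX u⁻¹ (toPoly gG)

theorem gG_keys : ∀ t ∈ gG, t.2.1 + t.2.2.1 + t.2.2.2 = 10 := by decide +kernel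

theorem toPoly_hom (D : List (ℤ × ℕ × ℕ × ℕ)) (d : ℕ)
    (h : ∀ t ∈ D, t.2.1 + t.2.2.1 + t.2.2.2 = d) : (toPoly D).IsHomogeneous d := by
  induction D with
  | nil => simpa [toPoly] using isHomogeneous_zero (Fin 3) ℝ d
  | cons t D ih =>
    have h1 := mono_hom t.2
    rw [h t (by simp)] at h1
    have h2 := (isHomogeneous_C (Fin 3) (t.1 : ℝ)).mul h1
    rw [zero_add] at h2
    have := h2.add (ih fun s hs => h s (by simp [hs]))
    simpa [toPoly] using this

theorem SX_F : SX u theF = C (∏ i, kap i) * ((∏ i, linP (Lf i)) * toPoly gG) := by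
  apply MvPolynomial.funext
  intro V
  have h : sc u⁻¹ (sc u V) = V := by
    ext i; fin_cases i <;> simp [sc, u_ne]
  rw [eval_SX, theF]
  simp only [map_mul, map_prod, eval_C, eval_SX, h, line_ev, eval_linP, Finset.prod_mul_distrib]
  ring

theorem SX_F_hom : (SX u theF).IsHomogeneous 31 := by
  rw [SX_F]
  have h1 : (∏ i, linP (Lf i)).IsHomogeneous 21 := by
    simpa using IsHomogeneous.prod Finset.univ (fun i => linP (Lf i)) (fun _ => 1)
      (fun i _ => linP_hom (Lf i))
  have h2 := h1.mul (toPoly_hom gG 10 gG_keys)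
  have h3 := (isHomogeneous_C (Fin 3) (∏ i, kap i)).mul h2
  simpa using h3

theorem linL_ofFn : linL = List.ofFn Lf := by decide +kernel

def rv (n : ℤ × ℤ × ℤ) : Fin 3 → ℝ := ![(n.1 : ℝ), n.2.1, n.2.2]

theorem eval_rv (D : List (ℤ × ℕ × ℕ × ℕ)) (n : ℤ × ℤ × ℤ) :
    eval (rv n) (toPoly D) = (ivalD D n : ℝ) := by
  rw [← evL_apply, map_toPoly, ivalD, Int.cast_list_sum, List.map_map]
  congr 1
  apply List.map_congr_left
  intro t _
  rw [evL_apply]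
  simp [mono, rv, mul_assoc]

theorem lr_rv (l n : ℤ × ℤ × ℤ) : lr l (rv n) = (lval l n : ℝ) := by
  simp [lr, rv, lval]

theorem pt_rv (sx sy : ℤ) (q : ℕ × ℕ × ℕ) : pt sx sy q = rv (sgn sx sy q) := by
  ext i; fin_cases i <;> simp [pt, rv, sgn]

theorem eval_F (sx sy : ℤ) (q : ℕ × ℕ × ℕ) : eval (pt sx sy q) (SX u theF) =
    (∏ i, kap i) * (fval (sgn sx sy q) : ℝ) := by
  rw [SX_F, pt_rv, fval, linL_ofFn, List.map_ofFn, List.prod_ofFn]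
  simp only [map_mul, map_prod, eval_C, eval_linP, eval_rv, lr_rv]
  simp only [Function.comp]
  push_cast
  rfl

theorem phi_F : phi (SX u theF) ≠ 0 := by
  have hm : SX u theF ∈ homogeneousSubmodule (Fin 3) ℝ 31 := SX_F_hom
  rw [phi, LinearMap.comp_apply, homogeneousComponent_of_mem hm, if_pos rfl, phi0, lsum_apply]
  have h : (wQ.map fun t => (t.1 : ℝ) * E 0 1 t.2 (SX u theF)).sum = (∏ i, kap i) *
      (((wQ.map fun t => t.1 * (fval (sgn 1 1 t.2) + fval (sgn (-1) 1 t.2)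
    - fval (sgn 1 (-1) t.2) - fval (sgn (-1) (-1) t.2))).sum : ℤ) : ℝ) := by
    rw [Int.cast_list_sum, List.map_map, ← List.sum_map_mul_left]
    congr 1
    apply List.map_congr_left
    intro t _
    simp only [E_apply, eval_F, Function.comp]
    push_cast
    ring
  rw [h]
  exact mul_ne_zero (Finset.prod_ne_zero_iff.2 fun i _ => kap_ne i) (Int.cast_ne_zero.2 phi_f_check)

theorem J_le : (⨅ P ∈ T21, pointIdeal (Projectivization.rep P)) ≤ KI.comap (SX u) := by
  intro a ha q hq sx hsx sy hsy c
  obtain ⟨hq0, i, j, hij, hi, hj⟩ := reps_check q hq sx hsx sy hsy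
  rw [eval_SX, sc_smul]
  have hsx0 : (sx : ℝ) ≠ 0 := by
    simp only [List.mem_cons, List.not_mem_nil, or_false] at hsx
    rcases hsx with rfl | rfl <;> norm_num
  have hsy0 : (sy : ℝ) ≠ 0 := by
    simp only [List.mem_cons, List.not_mem_nil, or_false] at hsy
    rcases hsy with rfl | rfl <;> norm_num
  have hv : sc u (pt sx sy q) ≠ 0 := by
    intro h
    apply hq0
    have h0 := congrFun h 0
    have h1 := congrFun h 1
    have h2 := congrFun h 2
    simp [sc, pt, u_ne, hsx0, hsy0] at h0 h1 h2
    exact Prod.ext h0 (Prod.ext h1 h2)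
  obtain ⟨r, hr⟩ := Projectivization.exists_smul_eq_mk_rep ℝ _ hv
  have hr' : (r : ℝ) • sc u (pt sx sy q) =
    Projectivization.rep (Projectivization.mk ℝ (sc u (pt sx sy q)) hv) := hr
  have hline : ∀ k : Fin 21, lval (Lf k) (sgn sx sy q) = 0 →
      eval (Projectivization.rep (Projectivization.mk ℝ (sc u (pt sx sy q)) hv)) (linesB21 k) = 0 := by
    intro k hk
    rw [← hr', ← sc_smul, line_ev, lr_smul, pt_rv, lr_rv, hk]; simp
  have hT : Projectivization.mk ℝ (sc u (pt sx sy q)) hv ∈ T21 := by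
    change 2 ≤ multB21 _
    unfold multB21
    classical
    have : ({i, j} : Finset (Fin 21)).card = 2 := Finset.card_pair hij
    rw [← this]
    apply Finset.card_le_card
    intro k hk
    rw [Finset.mem_filter]
    refine ⟨Finset.mem_univ _, ?_⟩
    rcases Finset.mem_insert.1 hk with rfl | hk
    · exact hline _ hi
    · rw [Finset.mem_singleton.1 hk]; exact hline _ hj
  have hmem : a ∈ pointIdeal (Projectivization.rep (Projectivization.mk ℝ (sc u (pt sx sy q)) hv)) := by
    rw [Submodule.mem_iInf] at ha
    have := ha (Projectivization.mk ℝ (sc u (pt sx sy q)) hv)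
    rw [Submodule.mem_iInf] at this
    exact this hT
  have h3 := hmem (c * (r : ℝ)⁻¹)
  rw [← hr', smul_smul, mul_assoc, inv_mul_cancel₀ r.ne_zero, mul_one] at h3
  exact h3

theorem F_not_mem : theF ∉ (⨅ P ∈ T21, pointIdeal (Projectivization.rep P)) ^ 2 := by
  intro h
  apply phi_F
  apply phi_sq
  have h1 := Ideal.mem_map_of_mem (SX u) h
  rw [Ideal.map_pow] at h1
  exact Ideal.pow_right_mono (Ideal.map_le_iff_le_comap.2 J_le) 2 h1

theorem F_mem (P : P2R) (hP : P ∈ T21) : theF ∈ (pointIdeal (Projectivization.rep P)) ^ 3 := by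
  classical
  set v := Projectivization.rep P with hv
  have hv0 : v ≠ 0 := Projectivization.rep_nonzero P
  set V := sc u⁻¹ v with hV
  set S := Finset.univ.filter fun i => eval v (linesB21 i) = 0 with hS
  have hmS : ∀ i, i ∈ S ↔ lr (Lf i) V = 0 := by
    intro i; rw [hS, Finset.mem_filter, line_zero, ← hV]; simp
  have hc : 2 ≤ S.card := by
    have h : 2 ≤ multB21 P := hP
    unfold multB21 at h
    convert h
  have hlin : ∀ i ∈ S, linesB21 i ∈ pointIdeal v := by
    intro i hi c
    rw [line_zero, sc_smul, lr_smul, (hmS i).1 hi, mul_zero]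
  have hprod : ∏ i ∈ S, linesB21 i ∈ pointIdeal v ^ S.card := by
    have := Ideal.prod_mem_prod (s := S) (I := fun _ => pointIdeal v) (x := linesB21) hlin
    rwa [Finset.prod_const] at this
  have hall : ∏ i, linesB21 i ∈ pointIdeal v ^ S.card := by
    rw [← Finset.prod_mul_prod_compl S]
    exact Ideal.mul_mem_right _ _ hprod
  by_cases h3 : 3 ≤ S.card
  · exact Ideal.mul_mem_right _ _ (Ideal.pow_le_pow_right h3 hall)
  have h2 : S.card = 2 := by omega
  rw [h2] at hall
  have hg : SX u⁻¹ (toPoly gG) ∈ pointIdeal v := by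
    obtain ⟨i, j, hij, hSe⟩ := Finset.card_eq_two.1 h2
    have hi : lr (Lf i) V = 0 := (hmS i).1 (by rw [hSe]; simp)
    have hj : lr (Lf j) V = 0 := (hmS j).1 (by rw [hSe]; simp)
    obtain ⟨hn, hor⟩ := pair_check i j hij
    set n := crs (Lf i) (Lf j) with hn'
    have hpar : ∀ a b : Fin 3, rv n a * V b = V a * rv n b := by
      have n0 : rv n 0 = ((Lf i).2.1 : ℝ) * (Lf j).2.2 - (Lf i).2.2 * (Lf j).2.1 := by
        simp [rv, hn', crs]
      have n1 : rv n 1 = ((Lf i).2.2 : ℝ) * (Lf j).1 - (Lf i).1 * (Lf j).2.2 := by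
        simp [rv, hn', crs]
      have n2 : rv n 2 = ((Lf i).1 : ℝ) * (Lf j).2.1 - (Lf i).2.1 * (Lf j).1 := by
        simp [rv, hn', crs]
      unfold lr at hi hj
      have h01 : rv n 0 * V 1 = V 0 * rv n 1 := by
        rw [n0, n1]; linear_combination (-((Lf i).2.2 : ℝ)) * hj + ((Lf j).2.2 : ℝ) * hi
      have h02 : rv n 0 * V 2 = V 0 * rv n 2 := by
        rw [n0, n2]; linear_combination (((Lf i).2.1 : ℝ)) * hj - ((Lf j).2.1 : ℝ) * hi
      have h12 : rv n 1 * V 2 = V 1 * rv n 2 := by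
        rw [n1, n2]; linear_combination (-((Lf i).1 : ℝ)) * hj + ((Lf j).1 : ℝ) * hi
      intro a b
      fin_cases a <;> fin_cases b <;> simp only [Fin.zero_eta, Fin.mk_one, Fin.reduceFinMk] <;>
        first
          | linear_combination h01
          | linear_combination h02
          | linear_combination h12
          | linear_combination -h01
          | linear_combination -h02
          | linear_combination -h12
          | ring
    obtain ⟨a, ha⟩ : ∃ a, rv n a ≠ 0 := by
      by_contra hcon
      push Not at hcon
      apply hn
      have h0 := hcon 0
      have h1 := hcon 1
      have h2 := hcon 2
      simp [rv] at h0 h1 h2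
      exact Prod.ext h0 (Prod.ext h1 h2)
    have hsm : rv n a • V = V a • rv n := by
      ext b; simpa using hpar a b
    rcases hor with ⟨k, hki, hkj, hk⟩ | hgn
    · exfalso
      have h4 := lr_smul (Lf k) (rv n a) V
      rw [hsm, lr_smul, lr_rv, hk, Int.cast_zero, mul_zero] at h4
      have h5 : lr (Lf k) V = 0 := by
        rcases mul_eq_zero.1 h4.symm with h | h
        · exact absurd h ha
        · exact h
      have h6 := (hmS k).2 h5
      rw [hSe] at h6
      simp [hki, hkj] at h6
    · have h4 := hom_eval_smul 10 _ (toPoly_hom gG 10 gG_keys) (rv n a) V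
      rw [hsm, hom_eval_smul 10 _ (toPoly_hom gG 10 gG_keys), eval_rv, hgn, Int.cast_zero,
        mul_zero] at h4
      have h5 : eval V (toPoly gG) = 0 := by
        rcases mul_eq_zero.1 h4.symm with h | h
        · exact absurd h (pow_ne_zero _ ha)
        · exact h
      intro c
      rw [eval_SX, sc_smul, hom_eval_smul 10 _ (toPoly_hom gG 10 gG_keys), ← hV, h5, mul_zero]
  rw [pow_succ]
  exact Ideal.mul_mem_mul hall hg

end


/-- **Theorem B.** For the ideal `J` of the 115 intersection points of the arrangement
`B₂₁` of 21 lines, the third symbolic power `J^(3) = ⋂_P I(P)³` is not contained in `J²`. -/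
theorem stmt2 :
    ¬ (⨅ P ∈ T21, (pointIdeal (Projectivization.rep P)) ^ 3) ≤
      (⨅ P ∈ T21, pointIdeal (Projectivization.rep P)) ^ 2 := by
  intro h
  apply F_not_mem
  apply h
  rw [Submodule.mem_iInf]
  intro P
  rw [Submodule.mem_iInf]
  exact fun hP => F_mem P hP
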